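/- Let c(2n) denote the number of square-lattice walks of length 2n that start at (0,0), end at (0,0), and are confined to the three-quadrant cone C. Then c(2n) is asymptotically equivalent, as n → ∞, to (2^9 / 3^4) · (Γ(2/3) / π) · 4^{2n} / (2n)^{5/3}, where Γ is the Gamma function. -/

import Mathlib

/-- Square-lattice steps. -/
def squareSteps : Set (ℤ × ℤ) := {(1,0), (-1,0), (0,1), (0,-1)}

/-- Diagonal-lattice steps. -/
def diagSteps : Set (ℤ × ℤ) := {(1,1), (1,-1), (-1,1), (-1,-1)}

/-- The three-quadrant cone `C = {(i,j) : i ≥ 0 or j ≥ 0}`. -/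
def coneC : Set (ℤ × ℤ) := {p | 0 ≤ p.1 ∨ 0 ≤ p.2}

/-- The quadrant `Q = {(i,j) : i ≥ 0 and j ≥ 0}`. -/
def quadQ : Set (ℤ × ℤ) := {p | 0 ≤ p.1 ∧ 0 ≤ p.2}

/-- Number of walks of length `n` with steps in `steps`, from `a` to `b`,
confined to `region`. -/
noncomputable def walkCount (steps region : Set (ℤ × ℤ)) (a b : ℤ × ℤ) (n : ℕ) : ℕ :=
  Nat.card {w : Fin (n+1) → ℤ × ℤ //
    w 0 = a ∧ w (Fin.last n) = b ∧
    (∀ k : Fin n, w k.succ - w k.castSucc ∈ steps) ∧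
    (∀ k, w k ∈ region)}

namespace PowerSeries

section Diagonal

variable {R : Type*} [CommRing R]

/-- Two power series congruent modulo every power of the variable are equal. -/
theorem eq_zero_of_forall_X_pow_dvd {f : R⟦X⟧} (h : ∀ n : ℕ, (X : R⟦X⟧) ^ n ∣ f) : f = 0 := by
  ext n
  exact (X_pow_dvd_iff.1 (h (n + 1))) n n.lt_succ_self

/-- A fixed point of `f ↦ c + X * G f`, where `G` preserves congruences. -/
theorem exists_eq_add_X_mul (c : R⟦X⟧) (G : R⟦X⟧ → R⟦X⟧) (hG : ∀ f g, f - g ∣ G f - G g) :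
    ∃ f, f = c + X * G f := by
  let Φ : R⟦X⟧ → R⟦X⟧ := fun f => c + X * G f
  have hΦ : ∀ (n : ℕ) f g, (X : R⟦X⟧) ^ n ∣ f - g → (X : R⟦X⟧) ^ (n + 1) ∣ Φ f - Φ g := by
    intro n f g h
    have : Φ f - Φ g = X * (G f - G g) := by simp only [Φ]; ring
    rw [this, pow_succ']
    exact mul_dvd_mul_left _ (h.trans (hG f g))
  let s : ℕ → R⟦X⟧ := fun n => Φ^[n] 0
  have hs : ∀ n, s (n + 1) = Φ (s n) := fun n => Function.iterate_succ_apply' Φ n 0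
  have h1 : ∀ n, (X : R⟦X⟧) ^ n ∣ s (n + 1) - s n := by
    intro n
    induction n with
    | zero => simp
    | succ n ih =>
      rw [hs (n + 1), hs n]
      exact hΦ n _ _ (by rw [← hs n]; exact ih)
  have h2 : ∀ n m, (X : R⟦X⟧) ^ n ∣ s (n + m) - s n := by
    intro n m
    induction m with
    | zero => simp
    | succ m ih =>
      have := dvd_add ((pow_dvd_pow _ (Nat.le_add_right n m)).trans (h1 (n + m))) ih
      rwa [sub_add_sub_cancel] at this
  let f : R⟦X⟧ := mk fun n => coeff n (s (n + 1))
  have h3 : ∀ n, (X : R⟦X⟧) ^ n ∣ f - s n := by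
    intro n
    rw [X_pow_dvd_iff]
    intro m hm
    obtain ⟨k, rfl⟩ := Nat.exists_eq_add_of_lt hm
    have := X_pow_dvd_iff.1 (h2 (m + 1) k) m m.lt_succ_self
    rw [map_sub, sub_eq_zero] at this ⊢
    rw [show m + k + 1 = m + 1 + k by ring, this]
    simp [f]
  refine ⟨f, ?_⟩
  rw [← sub_eq_zero]
  refine eq_zero_of_forall_X_pow_dvd fun n => ?_
  have h4 := (pow_dvd_pow (X : R⟦X⟧) n.le_succ).trans (hΦ n _ _ (h3 n))
  have h5 := (pow_dvd_pow (X : R⟦X⟧) n.le_succ).trans (h3 (n + 1))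
  rw [hs n] at h5
  have := dvd_sub h5 h4
  rwa [sub_sub_sub_cancel_right] at this

theorem exists_mul_one_sub_X_mul_eq_one (c : R⟦X⟧) : ∃ y, y * (1 - X * c) = 1 := by
  obtain ⟨y, hy⟩ := exists_eq_add_X_mul 1 (fun f => c * f) fun f g => ⟨c, by ring⟩
  exact ⟨y, by linear_combination hy⟩

/-- The substitution of `X` for the outer variable of an iterated power series, as a function. -/
noncomputable def diagFun (f : R⟦X⟧⟦X⟧) : R⟦X⟧ :=
  mk fun N => ∑ p ∈ Finset.HasAntidiagonal.antidiagonal N, coeff p.2 (coeff p.1 f)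

theorem coeff_diagFun (f : R⟦X⟧⟦X⟧) (N : ℕ) :
    coeff N (diagFun f) = ∑ p ∈ Finset.HasAntidiagonal.antidiagonal N, coeff p.2 (coeff p.1 f) :=
  coeff_mk _ _

theorem coeff_diagFun_eq_eval {f : R⟦X⟧⟦X⟧} {N : ℕ} {p : Polynomial R⟦X⟧}
    (h : ∀ i ≤ N, p.coeff i = coeff i f) :
    coeff N (diagFun f) = coeff N (p.eval X) := by
  rw [coeff_diagFun, Polynomial.eval_eq_sum_range' (n := max (N + 1) (p.natDegree + 1)) (by omega),
    map_sum, Finset.Nat.sum_antidiagonal_eq_sum_range_succ_mk]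
  have hsub : Finset.range N.succ ⊆ Finset.range (max (N + 1) (p.natDegree + 1)) :=
    Finset.range_subset_range.2 (le_max_left _ _)
  rw [← Finset.sum_subset hsub]
  · refine Finset.sum_congr rfl fun i hi => ?_
    have hi' : i ≤ N := Nat.lt_succ_iff.1 (Finset.mem_range.1 hi)
    rw [h i hi', coeff_mul_X_pow', if_pos hi']
  · intro i _ hi
    rw [coeff_mul_X_pow', if_neg]
    simpa using hi

/-- The substitution of `X` for the outer variable of an iterated power series. -/
noncomputable def diag : R⟦X⟧⟦X⟧ →+* R⟦X⟧ where
  toFun := diagFun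
  map_zero' := by ext N; simp [coeff_diagFun]
  map_add' f g := by ext N; simp [coeff_diagFun, Finset.sum_add_distrib]
  map_one' := by
    ext N
    rw [coeff_diagFun_eq_eval (p := 1), Polynomial.eval_one]
    intro i _
    rw [Polynomial.coeff_one, coeff_one]
  map_mul' f g := by
    ext N
    have key : ∀ (f : R⟦X⟧⟦X⟧) (M : ℕ), M ≤ N →
        coeff M (diagFun f) = coeff M ((trunc (N + 1) f).eval X) := by
      intro f M hM
      refine coeff_diagFun_eq_eval fun i hi => ?_
      rw [coeff_trunc, if_pos (by omega)]
    rw [coeff_diagFun_eq_eval (p := trunc (N + 1) f * trunc (N + 1) g), Polynomial.eval_mul,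
      coeff_mul, coeff_mul]
    · refine Finset.sum_congr rfl fun p hp => ?_
      have := Finset.HasAntidiagonal.mem_antidiagonal.1 hp
      rw [key f p.1 (by omega), key g p.2 (by omega)]
    · intro i hi
      rw [coeff_mul, Polynomial.coeff_mul]
      refine Finset.sum_congr rfl fun p hp => ?_
      have := Finset.HasAntidiagonal.mem_antidiagonal.1 hp
      rw [coeff_trunc, coeff_trunc, if_pos (by omega), if_pos (by omega)]

theorem coeff_diag (f : R⟦X⟧⟦X⟧) (N : ℕ) :
    coeff N (diag f) = ∑ p ∈ Finset.HasAntidiagonal.antidiagonal N, coeff p.2 (coeff p.1 f) :=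
  coeff_diagFun f N

@[simp]
theorem diag_C (f : R⟦X⟧) : diag (C f) = f := by
  ext N
  rw [coeff_diag, Finset.Nat.sum_antidiagonal_eq_sum_range_succ_mk, Finset.sum_range_succ',
    Finset.sum_eq_zero]
  · simp
  · intro i _
    simp

@[simp]
theorem diag_map_C (f : R⟦X⟧) : diag (map C f) = f := by
  ext N
  rw [coeff_diag, Finset.Nat.sum_antidiagonal_eq_sum_range_succ_mk, Finset.sum_range_succ,
    Finset.sum_eq_zero]
  · simp
  · intro i hi
    have := Finset.mem_range.1 hi
    simp only [coeff_map, coeff_C]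
    rw [if_neg (by omega)]

end Diagonal

end PowerSeries

section WalkRecursion

/-- The walks counted by `walkCount`. -/
abbrev ConfinedWalk (steps region : Set (ℤ × ℤ)) (a b : ℤ × ℤ) (n : ℕ) : Type :=
  {w : Fin (n+1) → ℤ × ℤ //
    w 0 = a ∧ w (Fin.last n) = b ∧
    (∀ k : Fin n, w k.succ - w k.castSucc ∈ steps) ∧
    (∀ k, w k ∈ region)}

variable {region : Set (ℤ × ℤ)} {a b : ℤ × ℤ} {n : ℕ}

theorem ConfinedWalk.sigma_ext {steps : Set (ℤ × ℤ)}
    {p q : Σ s : steps, ConfinedWalk steps region a (b - s) n} (h : p.2.1 = q.2.1) : p = q := by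
  obtain ⟨⟨s, hs⟩, ⟨w, hw⟩⟩ := p
  obtain ⟨⟨t, ht⟩, ⟨v, hv⟩⟩ := q
  change w = v at h
  subst h
  have : s = t := by simpa using hw.2.1.symm.trans hv.2.1
  subst this
  rfl

/-- Removing the last step of a confined walk. -/
def confinedWalkSuccEquiv (steps : Set (ℤ × ℤ)) (hb : b ∈ region) :
    ConfinedWalk steps region a b (n + 1) ≃
      Σ s : steps, ConfinedWalk steps region a (b - s) n where
  toFun w := ⟨⟨b - w.1 (Fin.last n).castSucc, by
      have h := w.2.2.2.1 (Fin.last n)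
      rwa [Fin.succ_last, w.2.2.1] at h⟩,
    ⟨fun k => w.1 k.castSucc, w.2.1, by simp, fun k => w.2.2.2.1 k.castSucc,
      fun k => w.2.2.2.2 _⟩⟩
  invFun p := ⟨Fin.snoc (α := fun _ => ℤ × ℤ) p.2.1 b,
    (Fin.snoc_castSucc (α := fun _ => ℤ × ℤ) b p.2.1 0).trans p.2.2.1,
      by simp, by
      intro k
      induction k using Fin.lastCases with
      | last =>
        rw [Fin.succ_last, Fin.snoc_last, Fin.snoc_castSucc, p.2.2.2.1, sub_sub_cancel]
        exact p.1.2
      | cast k =>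
        rw [← Fin.castSucc_succ, Fin.snoc_castSucc, Fin.snoc_castSucc]
        exact p.2.2.2.2.1 k, by
      intro k
      induction k using Fin.lastCases with
      | last => rwa [Fin.snoc_last]
      | cast k => rw [Fin.snoc_castSucc]; exact p.2.2.2.2.2 k⟩
  left_inv w := by
    ext1
    funext k
    induction k using Fin.lastCases with
    | last => simp [w.2.2.1]
    | cast k => simp
  right_inv p := by
    refine ConfinedWalk.sigma_ext (funext fun k => ?_)
    simp

theorem finite_confinedWalk (steps : Finset (ℤ × ℤ)) (region : Set (ℤ × ℤ)) (a b : ℤ × ℤ) (n : ℕ) :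
    Finite (ConfinedWalk steps region a b n) := by
  induction n generalizing b with
  | zero =>
    have : Subsingleton (ConfinedWalk steps region a b 0) := by
      refine ⟨fun v w => ?_⟩
      ext1
      funext k
      rw [Fin.fin_one_eq_zero k, v.2.1, w.2.1]
    infer_instance
  | succ n ih =>
    by_cases hb : b ∈ region
    · exact Finite.of_equiv _ (confinedWalkSuccEquiv _ hb).symm
    · have : IsEmpty (ConfinedWalk steps region a b (n + 1)) :=
        ⟨fun w => hb (w.2.2.1 ▸ w.2.2.2.2 (Fin.last _))⟩
      infer_instance

theorem walkCount_of_notMem (steps : Set (ℤ × ℤ)) (hb : b ∉ region) :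
    walkCount steps region a b n = 0 := by
  have : IsEmpty (ConfinedWalk steps region a b n) :=
    ⟨fun w => hb (w.2.2.1 ▸ w.2.2.2.2 (Fin.last _))⟩
  exact Nat.card_of_isEmpty

theorem walkCount_zero (steps : Set (ℤ × ℤ)) (ha : a ∈ region) :
    walkCount steps region a b 0 = if b = a then 1 else 0 := by
  have : Subsingleton (ConfinedWalk steps region a b 0) := by
    refine ⟨fun v w => ?_⟩
    ext1
    funext k
    rw [Fin.fin_one_eq_zero k, v.2.1, w.2.1]
  split_ifs with h
  · have : Nonempty (ConfinedWalk steps region a b 0) :=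
      ⟨⟨fun _ => a, rfl, h.symm, fun k => k.elim0, fun _ => ha⟩⟩
    exact Nat.card_unique
  · have : IsEmpty (ConfinedWalk steps region a b 0) :=
      ⟨fun w => h (w.2.2.1.symm.trans w.2.1)⟩
    exact Nat.card_of_isEmpty

theorem walkCount_succ (steps : Finset (ℤ × ℤ)) (hb : b ∈ region) :
    walkCount steps region a b (n + 1) = ∑ s ∈ steps, walkCount steps region a (b - s) n := by
  have := fun b => finite_confinedWalk steps region a b n
  rw [walkCount, Nat.card_congr (confinedWalkSuccEquiv _ hb), Nat.card_sigma]
  exact Finset.sum_coe_sort steps fun s => walkCount steps region a (b - s) n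

end WalkRecursion

/-- Walks in the three-quadrant cone, with the apex of the cone shifted to `(1, 1)`. -/
noncomputable def coneWalks (n : ℕ) (i j : ℤ) : ℚ :=
  walkCount squareSteps coneC (0, 0) (i - 1, j - 1) n

theorem coneWalks_zero (i j : ℤ) : coneWalks 0 i j = if i = 1 ∧ j = 1 then 1 else 0 := by
  rw [coneWalks, walkCount_zero _ (by simp [coneC])]
  simp [sub_eq_zero]

theorem coneWalks_eq_zero {n : ℕ} {i j : ℤ} (hi : i ≤ 0) (hj : j ≤ 0) : coneWalks n i j = 0 := by
  rw [coneWalks, walkCount_of_notMem, Nat.cast_zero]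
  simp only [coneC, Set.mem_ofPred_eq, not_or]
  omega

theorem coneWalks_succ {n : ℕ} {i j : ℤ} (h : 0 < i ∨ 0 < j) :
    coneWalks (n + 1) i j = coneWalks n (i + 1) j + coneWalks n (i - 1) j +
      coneWalks n i (j + 1) + coneWalks n i (j - 1) := by
  have hs : squareSteps = (({(1,0), (-1,0), (0,1), (0,-1)} : Finset (ℤ × ℤ)) : Set (ℤ × ℤ)) := by
    simp [squareSteps]
  have hb : ((i - 1, j - 1) : ℤ × ℤ) ∈ coneC := by
    simp only [coneC, Set.mem_ofPred_eq]
    omega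
  simp only [coneWalks]
  rw [hs, walkCount_succ _ hb]
  rw [Finset.sum_insert (by decide), Finset.sum_insert (by decide), Finset.sum_insert (by decide),
    Finset.sum_singleton]
  simp only [Prod.mk_sub_mk]
  push_cast
  ring_nf

theorem coneWalks_symm (n : ℕ) (i j : ℤ) : coneWalks n i j = coneWalks n j i := by
  induction n generalizing i j with
  | zero => simp only [coneWalks_zero, and_comm]
  | succ n ih =>
    by_cases h : 0 < i ∨ 0 < j
    · rw [coneWalks_succ h, coneWalks_succ h.symm, ih (i + 1), ih (i - 1), ih i, ih i]
      ring
    · rw [coneWalks_eq_zero (by omega) (by omega), coneWalks_eq_zero (by omega) (by omega)]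

theorem coneWalks_eq_zero_of_lt {n : ℕ} {i j : ℤ} (h : (n : ℤ) + 2 < |i| + |j|) :
    coneWalks n i j = 0 := by
  induction n generalizing i j with
  | zero =>
    rw [coneWalks_zero, if_neg]
    rintro ⟨rfl, rfl⟩
    norm_num at h
  | succ n ih =>
    by_cases hij : 0 < i ∨ 0 < j
    · push_cast at h
      rw [coneWalks_succ hij, ih, ih, ih, ih]
      · ring
      all_goals
        simp only [abs] at h ⊢
        grind
    · exact coneWalks_eq_zero (by omega) (by omega)

/-- The part of `reflectedWalks` supported on the reflections of the cone. -/
noncomputable def reflectionTerm (n : ℕ) (i j : ℤ) : ℚ :=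
  if 0 < j then coneWalks n j (-i) else if j < 0 then -coneWalks n (-j) (-i) else 0

/-- A function of the endpoint that satisfies the recursion of unconfined walks on a half plane. -/
noncomputable def reflectedWalks (n : ℕ) (i j : ℤ) : ℚ := coneWalks n i j + reflectionTerm n i j

theorem reflectionTerm_succ {n : ℕ} {i j : ℤ} (h : 0 < i + j) :
    reflectionTerm (n + 1) i j = reflectionTerm n (i + 1) j + reflectionTerm n (i - 1) j +
      reflectionTerm n i (j + 1) + reflectionTerm n i (j - 1) := by
  unfold reflectionTerm
  rcases lt_trichotomy 0 j with hj | rfl | hj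
  · have e1 : (if 0 < j - 1 then coneWalks n (j - 1) (-i) else
        if j - 1 < 0 then -coneWalks n (-(j - 1)) (-i) else 0) = coneWalks n (j - 1) (-i) := by
      by_cases h1 : 0 < j - 1
      · rw [if_pos h1]
      · rw [if_neg h1, if_neg (by omega), coneWalks_eq_zero (by omega) (by omega)]
    rw [e1]
    simp only [if_pos hj, if_pos (show 0 < j + 1 by omega)]
    rw [coneWalks_succ (Or.inl hj)]
    ring_nf
  · norm_num
  · have e1 : (if 0 < j + 1 then coneWalks n (j + 1) (-i) else
        if j + 1 < 0 then -coneWalks n (-(j + 1)) (-i) else 0) = -coneWalks n (-(j + 1)) (-i) := by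
      rw [if_neg (by omega)]
      by_cases h1 : j + 1 < 0
      · rw [if_pos h1]
      · rw [if_neg h1, coneWalks_eq_zero (by omega) (by omega), neg_zero]
    rw [e1]
    simp only [if_neg hj.not_gt, if_pos hj, if_neg (show ¬ 0 < j - 1 by omega),
      if_pos (show j - 1 < 0 by omega)]
    rw [coneWalks_succ (Or.inl (by omega))]
    ring_nf

theorem reflectedWalks_succ {n : ℕ} {i j : ℤ} (h : 0 < i + j) :
    reflectedWalks (n + 1) i j = reflectedWalks n (i + 1) j + reflectedWalks n (i - 1) j +
      reflectedWalks n i (j + 1) + reflectedWalks n i (j - 1) := by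
  unfold reflectedWalks
  rw [reflectionTerm_succ h, coneWalks_succ (by omega)]
  ring

theorem reflectedWalks_zero {i j : ℤ} (h : 0 < i + j) :
    reflectedWalks 0 i j = if i = 1 ∧ j = 1 then 1 else 0 := by
  unfold reflectedWalks reflectionTerm
  rw [coneWalks_zero, coneWalks_zero, coneWalks_zero,
    if_neg (show ¬ (j = 1 ∧ -i = 1) by omega), if_neg (show ¬ (-j = 1 ∧ -i = 1) by omega)]
  simp

theorem reflectedWalks_diag {k : ℤ} (n : ℕ) (hk : 0 < k) :
    reflectedWalks n k k = coneWalks n k k + coneWalks n k (-k) := by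
  rw [reflectedWalks, reflectionTerm, if_pos hk]

theorem reflectedWalks_antidiag {k : ℤ} (n : ℕ) (hk : 0 ≤ k) : reflectedWalks n k (-k) = 0 := by
  rw [reflectedWalks, reflectionTerm, if_neg (by omega)]
  split_ifs with h
  · rw [neg_neg, add_neg_cancel]
  · rw [coneWalks_eq_zero (by omega) (by omega), add_zero]

theorem reflectedWalks_antidiag_neg {k : ℤ} (n : ℕ) (hk : 0 < k) :
    reflectedWalks n (-k) k = coneWalks n k k + coneWalks n k (-k) := by
  rw [reflectedWalks, reflectionTerm, if_pos hk, neg_neg, coneWalks_symm n (-k), add_comm]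

theorem reflectedWalks_eq_zero_of_lt {n : ℕ} {i j : ℤ} (h : (n : ℤ) + 2 < |i| + |j|) :
    reflectedWalks n i j = 0 := by
  unfold reflectedWalks reflectionTerm
  rw [coneWalks_eq_zero_of_lt h, coneWalks_eq_zero_of_lt (by rwa [abs_neg, add_comm |j|]),
    coneWalks_eq_zero_of_lt (by rwa [abs_neg, abs_neg, add_comm |j|])]
  simp

theorem reflectedWalks_two_steps {n : ℕ} {k m : ℤ} (hk : 0 < k) :
    reflectedWalks (n + 2) (k + m) (k - m) =
      (reflectedWalks n (k + 1 + (m - 1)) (k + 1 - (m - 1)) +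
        2 * reflectedWalks n (k + 1 + m) (k + 1 - m) +
        reflectedWalks n (k + 1 + (m + 1)) (k + 1 - (m + 1))) +
      2 * (reflectedWalks n (k + (m - 1)) (k - (m - 1)) + 2 * reflectedWalks n (k + m) (k - m) +
        reflectedWalks n (k + (m + 1)) (k - (m + 1))) +
      (reflectedWalks n (k - 1 + (m - 1)) (k - 1 - (m - 1)) +
        2 * reflectedWalks n (k - 1 + m) (k - 1 - m) +
        reflectedWalks n (k - 1 + (m + 1)) (k - 1 - (m + 1))) := by
  rw [reflectedWalks_succ (by omega), reflectedWalks_succ (by omega),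
    reflectedWalks_succ (by omega), reflectedWalks_succ (by omega), reflectedWalks_succ (by omega)]
  ring_nf

section RowSeries

open LaurentPolynomial

theorem finite_support_reflectedWalks (n : ℕ) (k : ℤ) :
    (Function.support fun m : ℤ => reflectedWalks n (k + m) (k - m)).Finite := by
  refine (Set.finite_Icc (-(n + 2 : ℤ)) (n + 2)).subset fun m hm => ?_
  by_contra h
  refine hm (reflectedWalks_eq_zero_of_lt ?_)
  simp only [Set.mem_Icc, not_and_or, not_le] at h
  simp only [abs]
  grind

/-- The generating Laurent polynomial of `reflectedWalks` along a diagonal. -/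
noncomputable def rowPolynomial (n : ℕ) (k : ℤ) : ℚ[T;T⁻¹] :=
  .ofCoeff (Finsupp.ofSupportFinite _ (finite_support_reflectedWalks n k))

@[simp]
theorem coeff_rowPolynomial (n : ℕ) (k m : ℤ) :
    (rowPolynomial n k).coeff m = reflectedWalks n (k + m) (k - m) := rfl

theorem LaurentPolynomial.coeff_T_mul {R : Type*} [Semiring R] (p : R[T;T⁻¹]) (n m : ℤ) :
    (T n * p).coeff m = p.coeff (m - n) := by
  rw [T, AddMonoidAlgebra.coeff_single_mul_eq_mul_coeff (m - n), one_mul]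
  intro m' _
  omega

theorem rowPolynomial_succ (n : ℕ) {k : ℤ} (hk : 0 < k) :
    rowPolynomial (n + 2) k = (T 1 + 2 + T (-1)) *
      (rowPolynomial n (k + 1) + 2 * rowPolynomial n k + rowPolynomial n (k - 1)) := by
  have h2 : ∀ (p : ℚ[T;T⁻¹]) (m : ℤ), (2 * p).coeff m = 2 * p.coeff m := by
    intro p m
    rw [two_mul, AddMonoidAlgebra.coeff_add, Finsupp.add_apply, two_mul]
  ext m
  simp only [add_mul, AddMonoidAlgebra.coeff_add, Finsupp.add_apply, coeff_T_mul, h2,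
    coeff_rowPolynomial, reflectedWalks_two_steps hk, sub_neg_eq_add]
  ring

/-- The generating power series of the rows of `reflectedWalks` at even times. -/
noncomputable def rowSeries (k : ℕ) : PowerSeries ℚ[T;T⁻¹] :=
  .mk fun n => rowPolynomial (2 * n) k

theorem rowSeries_succ (k : ℕ) :
    rowSeries (k + 1) = (if k = 0 then 1 else 0) +
      PowerSeries.X * PowerSeries.C (T 1 + 2 + T (-1)) *
      (rowSeries (k + 2) + 2 * rowSeries (k + 1) + rowSeries k) := by
  have h2 : (2 : PowerSeries ℚ[T;T⁻¹]) = PowerSeries.C 2 := (map_ofNat _ 2).symm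
  ext1 n
  cases n with
  | zero =>
    rw [mul_assoc, map_add, PowerSeries.coeff_zero_X_mul, add_zero, rowSeries,
      PowerSeries.coeff_mk]
    ext m
    rw [coeff_rowPolynomial, mul_zero, reflectedWalks_zero (by push_cast; omega)]
    split_ifs with h h' h'
    · rw [PowerSeries.coeff_zero_one, ← T_zero, T, AddMonoidAlgebra.coeff_single,
        Finsupp.single_apply, if_pos (by omega)]
    · omega
    · rw [PowerSeries.coeff_zero_one, ← T_zero, T, AddMonoidAlgebra.coeff_single,
        Finsupp.single_apply, if_neg (by omega)]
    · simp
  | succ n =>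
    have h0 : PowerSeries.coeff (n + 1) (if k = 0 then 1 else 0 : PowerSeries ℚ[T;T⁻¹]) = 0 := by
      split_ifs <;> simp [PowerSeries.coeff_one]
    rw [mul_assoc, map_add, PowerSeries.coeff_succ_X_mul, h0, zero_add, h2,
      PowerSeries.coeff_C_mul]
    simp only [rowSeries, PowerSeries.coeff_mk, map_add, PowerSeries.coeff_C_mul]
    rw [mul_add, mul_one, rowPolynomial_succ _ (by positivity)]
    push_cast
    ring_nf

theorem coeff_rowSeries_zero (n : ℕ) {m : ℤ} (hm : 0 ≤ m) :
    (PowerSeries.coeff n (rowSeries 0)).coeff m = 0 := by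
  rw [rowSeries, PowerSeries.coeff_mk, coeff_rowPolynomial, Nat.cast_zero, zero_add, zero_sub,
    reflectedWalks_antidiag _ hm]

theorem coeff_rowSeries_zero_neg (n k : ℕ) :
    (PowerSeries.coeff n (rowSeries 0)).coeff (-(k + 1 : ℕ)) =
      (PowerSeries.coeff n (rowSeries (k + 1))).coeff 0 := by
  rw [rowSeries, rowSeries, PowerSeries.coeff_mk, PowerSeries.coeff_mk, coeff_rowPolynomial,
    coeff_rowPolynomial, Nat.cast_zero, zero_add, zero_sub, neg_neg,
    reflectedWalks_antidiag_neg _ (by positivity), add_zero, sub_zero,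
    reflectedWalks_diag _ (by positivity)]

theorem coeff_rowSeries_one (n : ℕ) :
    (PowerSeries.coeff n (rowSeries 1)).coeff 0 =
      coneWalks (2 * n) 1 1 + coneWalks (2 * n) 1 (-1) := by
  rw [rowSeries, PowerSeries.coeff_mk, coeff_rowPolynomial, add_zero, sub_zero, Nat.cast_one,
    reflectedWalks_diag _ one_pos]

end RowSeries

/-- Walks on the integer line. -/
def lineWalks : ℕ → ℤ → ℚ
  | 0, k => if k = 0 then 1 else 0
  | n + 1, k => lineWalks n (k - 1) + lineWalks n (k + 1)

theorem lineWalks_neg (n : ℕ) (k : ℤ) : lineWalks n (-k) = lineWalks n k := by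
  induction n generalizing k with
  | zero => simp [lineWalks]
  | succ n ih =>
    rw [lineWalks, lineWalks, show -k - 1 = -(k + 1) by ring, show -k + 1 = -(k - 1) by ring, ih,
      ih, add_comm]

theorem lineWalks_eq_zero {n : ℕ} {k : ℤ} (h : n < k) : lineWalks n k = 0 := by
  induction n generalizing k with
  | zero =>
    rw [lineWalks, if_neg]
    push_cast at h
    omega
  | succ n ih =>
    push_cast at h
    rw [lineWalks, ih (by omega), ih (by omega), add_zero]

theorem lineWalks_eq_choose (n k : ℕ) : lineWalks n (n - 2 * k) = n.choose k := by
  induction n generalizing k with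
  | zero =>
    cases k with
    | zero => simp [lineWalks]
    | succ k =>
      rw [lineWalks, if_neg (by push_cast; omega)]
      simp
  | succ n ih =>
    cases k with
    | zero =>
      have h := ih 0
      rw [lineWalks, lineWalks_eq_zero (k := _ + 1) (by push_cast; omega), add_zero,
        Nat.choose_zero_right]
      rw [Nat.choose_zero_right] at h
      rw [← h]
      push_cast
      ring_nf
    | succ k =>
      have h := ih k
      have h' := ih (k + 1)
      rw [lineWalks, Nat.choose_succ_succ', Nat.cast_add (R := ℚ), ← h, ← h', add_comm]
      push_cast
      ring_nf

/-- The number of walks confined to a quadrant, by reflection. -/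
def quadrantWalks (n : ℕ) (i j : ℤ) : ℚ :=
  lineWalks n (i + j - 2) * lineWalks n (i - j) - lineWalks n (i + j) * lineWalks n (i - j + 2) -
    lineWalks n (i + j) * lineWalks n (i - j - 2) + lineWalks n (i + j + 2) * lineWalks n (i - j)

theorem quadrantWalks_succ (n : ℕ) (i j : ℤ) :
    quadrantWalks (n + 1) i j = quadrantWalks n (i + 1) j + quadrantWalks n (i - 1) j +
      quadrantWalks n i (j + 1) + quadrantWalks n i (j - 1) := by
  simp only [quadrantWalks, lineWalks]
  ring_nf

theorem quadrantWalks_zero_left (n : ℕ) (j : ℤ) : quadrantWalks n 0 j = 0 := by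
  have h := lineWalks_neg n
  rw [quadrantWalks, show 0 - j = -(0 + j) by ring, show -(0 + j) + 2 = -(0 + j - 2) by ring,
    show -(0 + j) - 2 = -(0 + j + 2) by ring, h, h, h]
  ring

theorem quadrantWalks_comm (n : ℕ) (i j : ℤ) : quadrantWalks n i j = quadrantWalks n j i := by
  have h := lineWalks_neg n
  rw [quadrantWalks, quadrantWalks, show i - j = -(j - i) by ring,
    show -(j - i) + 2 = -(j - i - 2) by ring, show -(j - i) - 2 = -(j - i + 2) by ring, h, h, h]
  ring_nf

theorem coneWalks_sub_reflections (n : ℕ) {i j : ℤ} (hi : 0 ≤ i) (hj : 0 ≤ j) :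
    coneWalks n i j - coneWalks n (-i) j - coneWalks n i (-j) = quadrantWalks n i j := by
  induction n generalizing i j with
  | zero =>
    simp only [coneWalks_zero, quadrantWalks, lineWalks]
    rw [if_neg (show ¬ (-i = 1 ∧ j = 1) by omega), if_neg (show ¬ (i = 1 ∧ -j = 1) by omega),
      if_neg (show ¬ (i + j + 2 = 0) by omega)]
    have e1 : (if i + j = 0 then 1 else 0 : ℚ) * (if i - j + 2 = 0 then 1 else 0) = 0 := by
      split_ifs <;> first | omega | simp
    have e2 : (if i + j = 0 then 1 else 0 : ℚ) * (if i - j - 2 = 0 then 1 else 0) = 0 := by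
      split_ifs <;> first | omega | simp
    rw [e1, e2]
    split_ifs <;> first | omega | simp
  | succ n ih =>
    rcases hi.eq_or_lt with rfl | hi'
    · rw [quadrantWalks_zero_left, neg_zero, coneWalks_eq_zero (i := 0) (j := -j) le_rfl (by omega)]
      ring
    rcases hj.eq_or_lt with rfl | hj'
    · rw [quadrantWalks_comm, quadrantWalks_zero_left, neg_zero,
        coneWalks_eq_zero (i := -i) (j := 0) (by omega) le_rfl]
      ring
    · rw [quadrantWalks_succ, ← ih (by omega) hj, ← ih (by omega) hj, ← ih hi (by omega),
        ← ih hi (by omega), coneWalks_succ (Or.inl hi'), coneWalks_succ (Or.inr hj'),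
        coneWalks_succ (Or.inl hi')]
      ring_nf

/-- Excursions of length `2 * n` in a quadrant. -/
def quadrantExcursions (n : ℕ) : ℚ := quadrantWalks (2 * n) 1 1

theorem coneWalks_excursion (n : ℕ) :
    3 * coneWalks (2 * n) 1 1 =
      2 * (coneWalks (2 * n) 1 1 + coneWalks (2 * n) 1 (-1)) + quadrantExcursions n := by
  rw [quadrantExcursions, ← coneWalks_sub_reflections _ zero_le_one zero_le_one,
    coneWalks_symm _ (-1) 1]
  ring

theorem quadrantExcursions_eq (n : ℕ) :
    quadrantExcursions n * ((n + 1) ^ 2 * (n + 2)) = (n.centralBinom : ℚ) ^ 2 * (4 * n + 2) := by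
  have h0 := lineWalks_eq_choose (2 * n) n
  have h1 := lineWalks_eq_choose (2 * n) (n + 1)
  have h2 := lineWalks_eq_choose (2 * n) (n + 2)
  push_cast at h0 h1 h2
  rw [show (2 * n - 2 * n : ℤ) = 0 by ring, ← Nat.centralBinom_eq_two_mul_choose] at h0
  rw [show (2 * n - 2 * (n + 1) : ℤ) = -2 by ring, lineWalks_neg] at h1
  rw [show (2 * n - 2 * (n + 2) : ℤ) = -4 by ring, lineWalks_neg] at h2
  have c1 : ((2 * n).choose (n + 1) : ℚ) * (n + 1) = n.centralBinom * n := by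
    have := Nat.choose_succ_right_eq (2 * n) n
    rw [show 2 * n - n = n by omega, ← Nat.centralBinom_eq_two_mul_choose] at this
    exact_mod_cast this
  have c2 : ((2 * n).choose (n + 2) : ℚ) * (n + 2) = (2 * n).choose (n + 1) * (n - 1) := by
    rcases Nat.eq_zero_or_pos n with rfl | hn
    · simp
    have := Nat.choose_succ_right_eq (2 * n) (n + 1)
    rw [show 2 * n - (n + 1) = n - 1 by omega] at this
    have h' : ((n - 1 : ℕ) : ℚ) = n - 1 := by push_cast [hn]; ring
    rw [← h']
    exact_mod_cast this
  have e : quadrantExcursions n = (n.centralBinom : ℚ) ^ 2 - 2 * ((2 * n).choose (n + 1) : ℚ) ^ 2 +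
      n.centralBinom * (2 * n).choose (n + 2) := by
    have h3 := lineWalks_neg (2 * n) 2
    rw [quadrantExcursions, quadrantWalks]
    norm_num
    rw [h0, h1, h2, h3, h1]
    ring
  rw [e]
  generalize ((2 * n).choose (n + 1) : ℚ) = y at *
  generalize ((2 * n).choose (n + 2) : ℚ) = w at *
  linear_combination (-2 * (n + 2) * (y * (n + 1) + n.centralBinom * n) +
    n.centralBinom * (n + 1) * (n - 1)) * c1 + n.centralBinom * (n + 1) ^ 2 * c2

theorem quadrantExcursions_zero : quadrantExcursions 0 = 1 := by
  have := quadrantExcursions_eq 0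
  norm_num at this
  linarith

theorem quadrantExcursions_succ (n : ℕ) :
    quadrantExcursions (n + 1) * ((n + 2) * (n + 3)) =
      16 * quadrantExcursions n * ((n + 1 / 2) * (n + 3 / 2)) := by
  have h1 := quadrantExcursions_eq n
  have h2 := quadrantExcursions_eq (n + 1)
  have h3 : ((n : ℚ) + 1) * (n + 1).centralBinom = 2 * (2 * n + 1) * n.centralBinom := by
    exact_mod_cast Nat.succ_mul_centralBinom_succ n
  push_cast at h2
  generalize ((n + 1).centralBinom : ℚ) = v at *
  generalize (n.centralBinom : ℚ) = u at *
  have hn : (0 : ℚ) < n + 1 := by positivity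
  have hn' : (0 : ℚ) < n + 2 := by positivity
  have : ((n : ℚ) + 1) ^ 2 * (n + 2) ≠ 0 := by positivity
  refine mul_left_cancel₀ this ?_
  linear_combination ((n : ℚ) + 1) ^ 2 * h2  +
    (4 * n + 6) * ((n + 1) * v + 2 * (2 * n + 1) * u) * h3 -
    16 * ((n + 1 / 2) * (n + 3 / 2)) * h1

namespace KernelAlgebra

variable {R : Type*} [CommRing R] [IsDomain R]

section Parametrization

variable {g n u m κ r : R}

theorem mul_mul_denominator
    (hm : m * ((1 - 4 * g) * (1 - u * g * n)) = (1 - 2 * g * n) * (1 - 3 * g))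
    (hκ : κ * (1 - 3 * g) = g * (1 - 4 * g)) (h3 : 1 - 3 * g ≠ 0) (h4 : 1 - 4 * g ≠ 0) :
    κ * (u * m) * (1 - u * g * n) = g * u * (1 - 2 * g * n) := by
  refine mul_left_cancel₀ (mul_ne_zero h3 h4) ?_
  linear_combination u * m * (1 - 4 * g) * (1 - u * g * n) * hκ + g * (1 - 4 * g) * u * hm

theorem mul_one_sub_eq_one
    (hn : n * (1 - g * n) * (1 - u * g * (n + 1 - 2 * g * n)) = 1 - u * g * n)
    (hm : m * ((1 - 4 * g) * (1 - u * g * n)) = (1 - 2 * g * n) * (1 - 3 * g))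
    (hκ : κ * (1 - 3 * g) = g * (1 - 4 * g)) (h3 : 1 - 3 * g ≠ 0) (h4 : 1 - 4 * g ≠ 0)
    (hN : 1 - u * g * n ≠ 0) : n * (1 - g * n) * (1 - κ * (u * m)) = 1 := by
  refine mul_left_cancel₀ hN ?_
  linear_combination hn - n * (1 - g * n) * mul_mul_denominator hm hκ h3 h4

theorem cubic_of_parametrization
    (hn : n * (1 - g * n) * (1 - u * g * (n + 1 - 2 * g * n)) = 1 - u * g * n)
    (hm : m * ((1 - 4 * g) * (1 - u * g * n)) = (1 - 2 * g * n) * (1 - 3 * g))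
    (hκ : κ * (1 - 3 * g) = g * (1 - 4 * g)) (hr : r * (1 - 3 * g) ^ 2 = 1 - 4 * g)
    (h3 : 1 - 3 * g ≠ 0) (h4 : 1 - 4 * g ≠ 0) (hN : 1 - u * g * n ≠ 0) :
    u ^ 2 * (u * m - 1) = (u - 1) * r * (u * m) ^ 2 * (1 - κ * (u * m)) := by
  have hη := mul_one_sub_eq_one hn hm hκ h3 h4 hN
  have h5 : r * m ^ 2 * ((1 - 4 * g) * (1 - u * g * n) ^ 2) = (1 - 2 * g * n) ^ 2 := by
    refine mul_left_cancel₀ (mul_ne_zero h4 (pow_ne_zero 2 h3)) ?_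
    linear_combination (m * (1 - 4 * g) * (1 - u * g * n)) ^ 2 * hr +
      (1 - 4 * g) * (m * (1 - 4 * g) * (1 - u * g * n) + (1 - 2 * g * n) * (1 - 3 * g)) * hm
  have h0 : n * (1 - g * n) ≠ 0 := left_ne_zero_of_mul_eq_one hη
  refine mul_left_cancel₀ (mul_ne_zero h0 (mul_ne_zero h4 (pow_ne_zero 2 hN))) ?_
  linear_combination u ^ 3 * (1 - u * g * n) * (n * (1 - g * n)) * hm -
    (u - 1) * u ^ 2 * (n * (1 - g * n) * (1 - κ * (u * m))) * h5 -
    (u - 1) * u ^ 2 * (1 - 2 * g * n) ^ 2 * hη + u ^ 2 * (u * (1 - g * n) - 1) * hn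

end Parametrization

section Roots

variable {κ r σ z x y β η₁ η₂ η₃ : R}

theorem sum_eq_of_roots (hx : σ * (x - 1) = r * x ^ 2 * (1 - κ * x))
    (hy : σ * (y - 1) = r * y ^ 2 * (1 - κ * y)) (hxy : x ≠ y) :
    r * κ * ((x + y) ^ 2 - x * y) - r * (x + y) + σ = 0 := by
  refine mul_left_cancel₀ (sub_ne_zero.2 hxy) ?_
  linear_combination hx - hy

theorem prod_eq_of_roots (hx : σ * (x - 1) = r * x ^ 2 * (1 - κ * x))
    (hy : σ * (y - 1) = r * y ^ 2 * (1 - κ * y)) (hxy : x ≠ y) :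
    σ = r * (x * y) * (1 - κ * (x + y)) := by
  refine mul_left_cancel₀ (sub_ne_zero.2 hxy) ?_
  linear_combination y * hx - x * hy

theorem symmetric_relation (hx : σ * (x - 1) = r * x ^ 2 * (1 - κ * x))
    (hy : σ * (y - 1) = r * y ^ 2 * (1 - κ * y)) (hxy : x ≠ y) (hr : r ≠ 0) :
    (1 - κ * (x + y)) * (x * y - (x + y)) = κ * (x * y) := by
  refine mul_left_cancel₀ hr ?_
  linear_combination sum_eq_of_roots hx hy hxy - prod_eq_of_roots hx hy hxy

theorem eq_of_inverse (hx : σ * (x - 1) = r * x ^ 2 * (1 - κ * x))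
    (hy : σ * (y - 1) = r * y ^ 2 * (1 - κ * y)) (hxy : x ≠ y) (hr : r ≠ 0)
    (hβ : β * (1 - κ * (x + y)) = 1) (hz : z * r ^ 2 = κ) :
    β = 1 + z * (σ * r * (β ^ 2 * (1 - κ * β))) := by
  have h1 := prod_eq_of_roots hx hy hxy
  have h2 := symmetric_relation hx hy hxy hr
  have h3 : x + y = x * y * (1 - κ * β) := by
    linear_combination (x * y - (x + y)) * hβ - β * h2
  have h4 : β - 1 = β * (κ * (x + y)) := by linear_combination hβ
  linear_combination h4 + β * κ * h3 + (-z * r * β ^ 2 * (1 - κ * β)) * h1 -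
    x * y * (1 - κ * (x + y)) * β ^ 2 * (1 - κ * β) * hz - κ * (x * y) * β * (1 - κ * β) * hβ

/-- The invariant whose values at the three arguments of the functional equation are compared. -/
def invariant (κ r μ η : R) : R :=
  r * (-κ * (μ ^ 2 - 1) + (1 - κ) * (μ - 1) + (1 - κ) * η - 1)

theorem invariant_relation (hx : σ * (x - 1) = r * x ^ 2 * (1 - κ * x))
    (hy : σ * (y - 1) = r * y ^ 2 * (1 - κ * y)) (hxy : x ≠ y) (hr : r ≠ 0)
    (hβ : β * (1 - κ * (x + y)) = 1) (h₁ : η₁ * (1 - κ * x) = 1) (h₂ : η₂ * (1 - κ * y) = 1)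
    (h₃ : η₃ * (1 - κ * β) = 1) :
    invariant κ r x η₁ + invariant κ r y η₂ - invariant κ r β η₃ = σ - 2 * r * (1 - κ) := by
  have p := prod_eq_of_roots hx hy hxy
  have q := symmetric_relation hx hy hxy hr
  obtain ⟨D, hD⟩ : ∃ D, D = 1 - κ * (x + y) := ⟨_, rfl⟩
  rw [← hD] at p q hβ
  have e3 : η₃ * (D - κ) = D := by
    linear_combination D * h₃ + η₃ * κ * hβ
  have hDκ : D - κ ≠ 0 := by
    intro h
    rw [h, mul_zero] at e3
    rw [← e3, mul_zero] at hβ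
    exact zero_ne_one hβ
  have e4 : κ * (x * y) = (1 - D) * η₃ := by
    refine mul_left_cancel₀ hDκ ?_
    linear_combination (-(1 - D)) * e3 + κ * q + D * hD
  have e5 : D ^ 2 * (1 - κ) * (η₁ + η₂) = (D - κ) * (1 + D) := by
    have a1 : (D - κ) * ((1 - κ * x) * (1 - κ * y)) = D ^ 2 * (1 - κ) := by
      linear_combination κ ^ 2 * q + (κ * D - D + κ) * hD
    have a2 : (η₁ + η₂) * ((1 - κ * x) * (1 - κ * y)) = 1 + D := by
      linear_combination (1 - κ * y) * h₁ + (1 - κ * x) * h₂ - hD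
    linear_combination (D - κ) * a2 - (η₁ + η₂) * a1
  have e6 : (1 - κ) * (η₁ + η₂) = (D - κ) * (1 + D) * β ^ 2 := by
    linear_combination β ^ 2 * e5 - (1 - κ) * (η₁ + η₂) * (β * D + 1) * hβ
  simp only [invariant]
  linear_combination r * e6 + r * ((1 - κ) * β + β * D + 1) * hβ - p - r * q -
    r * (x + y + 1) * hD + r * e4 - r * e3

theorem eq_of_fixedPoint {c x y : R} (hx : x = 1 + z * (c * (x ^ 2 * (1 - κ * x))))
    (hy : y = 1 + z * (c * (y ^ 2 * (1 - κ * y))))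
    (h : 1 - z * (c * (x + y - κ * (x ^ 2 + x * y + y ^ 2))) ≠ 0) : x = y := by
  rw [← sub_eq_zero]
  refine mul_left_cancel₀ h ?_
  linear_combination hx - hy

end Roots

end KernelAlgebra

namespace KernelAlgebra

open PowerSeries

theorem exists_parametrization (R : Type*) [CommRing R] :
    ∃ h : R⟦X⟧, (X : R⟦X⟧) * (1 - 4 * (X * h)) = X * h * (1 - 3 * (X * h)) ^ 3 := by
  obtain ⟨h, hh⟩ := exists_eq_add_X_mul (1 : R⟦X⟧)
    (fun f => -4 * f + 9 * f ^ 2 - 27 * X * f ^ 3 + 27 * X ^ 2 * f ^ 4)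
    fun f g => ⟨-4 + 9 * (f + g) - 27 * X * (f ^ 2 + f * g + g ^ 2) +
      27 * X ^ 2 * (f + g) * (f ^ 2 + g ^ 2), by ring⟩
  exact ⟨h, by linear_combination -X * hh⟩

theorem exists_mul_one_sub_eq {R : Type*} [CommRing R] (h u : R⟦X⟧) :
    ∃ n : R⟦X⟧, n * (1 - X * h * n) * (1 - u * (X * h) * (n + 1 - 2 * (X * h) * n)) =
      1 - u * (X * h) * n := by
  obtain ⟨n, hn⟩ := exists_eq_add_X_mul (1 : R⟦X⟧)
    (fun f => -u * h * f + h * f ^ 2 + f * (1 - X * h * f) * u * h * (f + 1 - 2 * (X * h) * f))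
    fun f g => ⟨-u * h + h * (f + g) + u * h * ((f + g) * (1 - 2 * (X * h)) + 1
      - X * h * ((f ^ 2 + f * g + g ^ 2) * (1 - 2 * (X * h)) + (f + g))), by ring⟩
  exact ⟨n, by linear_combination hn⟩

theorem exists_eq_X_mul_sq {R : Type*} [CommRing R] (c : R⟦X⟧) :
    ∃ y : R⟦X⟧, y = X * (c * (1 + y) ^ 2) := by
  obtain ⟨y, hy⟩ := exists_eq_add_X_mul (0 : R⟦X⟧) (fun f => c * (1 + f) ^ 2)
    fun f g => ⟨c * (2 + f + g), by ring⟩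
  exact ⟨y, by simpa using hy⟩

theorem one_sub_X_mul_ne_zero {R : Type*} [CommRing R] [Nontrivial R] (c : R⟦X⟧) :
    1 - X * c ≠ 0 := by
  obtain ⟨y, hy⟩ := exists_mul_one_sub_X_mul_eq_one c
  exact right_ne_zero_of_mul_eq_one hy

end KernelAlgebra

section CoefficientFunctional

open PowerSeries LaurentPolynomial

/-- Applying a linear functional to the coefficients of a power series. -/
noncomputable def PowerSeries.mapFunctional {K M : Type*} [Field K] [CommRing M] [Algebra K M]
    (l : M →ₗ[K] K) : M⟦X⟧ →ₗ[K] K⟦X⟧ where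
  toFun f := .mk fun n => l (PowerSeries.coeff n f)
  map_add' f g := by ext n; simp
  map_smul' c f := by ext n; simp

namespace PowerSeries

variable {K M : Type*} [Field K] [CommRing M] [Algebra K M] (l : M →ₗ[K] K)

@[simp]
theorem coeff_mapFunctional (f : M⟦X⟧) (n : ℕ) :
    coeff n (mapFunctional l f) = l (coeff n f) := coeff_mk n fun n => l (coeff n f)

theorem mapFunctional_map_mul (c : K⟦X⟧) (f : M⟦X⟧) :
    mapFunctional l (map (algebraMap K M) c * f) = c * mapFunctional l f := by
  ext n
  simp [coeff_mul, ← Algebra.smul_def]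

theorem mapFunctional_map (c : K⟦X⟧) :
    mapFunctional l (map (algebraMap K M) c) = c * C (l 1) := by
  ext n
  simp [Algebra.algebraMap_eq_smul_one]

theorem mapFunctional_X_mul (f : M⟦X⟧) : mapFunctional l (X * f) = X * mapFunctional l f := by
  simpa using mapFunctional_map_mul l X f

theorem coeff_mapFunctional_diag (f : M⟦X⟧⟦X⟧) (N : ℕ) :
    coeff N (mapFunctional l (diag f)) = ∑ p ∈ Finset.HasAntidiagonal.antidiagonal N,
      coeff p.2 (mapFunctional l (coeff p.1 f)) := by
  simp [coeff_diag]

theorem mapFunctional_diag_congr {f g : M⟦X⟧⟦X⟧}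
    (h : ∀ i, mapFunctional l (coeff i f) = mapFunctional l (coeff i g)) :
    mapFunctional l (diag f) = mapFunctional l (diag g) := by
  ext N
  simp only [coeff_mapFunctional_diag, h]

end PowerSeries

namespace LaurentPolynomial

variable {K : Type*} [Field K]

/-- The constant coefficient, as a linear functional. -/
noncomputable def constantFunctional (K : Type*) [Field K] : K[T;T⁻¹] →ₗ[K] K :=
  (Finsupp.lapply 0).comp (AddMonoidAlgebra.coeffLinearEquiv K).toLinearMap

@[simp]
theorem constantFunctional_apply (p : K[T;T⁻¹]) : constantFunctional K p = p.coeff 0 := rfl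

/-- The derivative at `-1` of the part with positive exponents. -/
noncomputable def derivFunctional (K : Type*) [Field K] : K[T;T⁻¹] →ₗ[K] K :=
  (Finsupp.linearCombination K fun k : ℤ => if 0 < k then (-1 : K) ^ (k - 1) * k else 0).comp
    (AddMonoidAlgebra.coeffLinearEquiv K).toLinearMap

theorem derivFunctional_T (k : ℤ) :
    derivFunctional K (T k) = if 0 < k then (-1 : K) ^ (k - 1) * k else 0 := by
  change Finsupp.linearCombination K _ (Finsupp.single k (1 : K)) = _
  rw [Finsupp.linearCombination_single, one_smul]

theorem linearMap_ext {f g : K[T;T⁻¹] →ₗ[K] K} (h : ∀ k, f (T k) = g (T k)) : f = g := by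
  refine AddMonoidAlgebra.lhom_ext' fun k => LinearMap.ext_ring ?_
  exact h k

theorem derivFunctional_mul (p : K[T;T⁻¹]) :
    derivFunctional K ((T 1 + 2 + T (-1)) * p) = p.coeff 0 := by
  have h : (derivFunctional K).comp (LinearMap.mulLeft K (T 1 + 2 + T (-1))) =
      constantFunctional K := by
    refine linearMap_ext fun k => ?_
    rw [LinearMap.comp_apply, LinearMap.mulLeft_apply, add_mul, add_mul, two_mul, ← T_add, ← T_add]
    simp only [map_add, derivFunctional_T, constantFunctional_apply]
    rw [T, AddMonoidAlgebra.coeff_single, Finsupp.single_apply]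
    rcases lt_trichotomy k 0 with hk | rfl | hk
    · simp only [if_neg (show ¬ 0 < 1 + k by omega), if_neg (show ¬ 0 < k by omega),
        if_neg (show ¬ 0 < -1 + k by omega), if_neg hk.ne]
      ring
    · norm_num
    · have h1 : (-1 : K) ≠ 0 := by simp
      have e1 : (-1 : K) ^ (1 + k - 1) = -(-1) ^ (k - 1) := by
        rw [show 1 + k - 1 = k - 1 + 1 by ring, zpow_add_one₀ h1]
        ring
      have e2 : (-1 : K) ^ (-1 + k - 1) = -(-1) ^ (k - 1) := by
        rw [show -1 + k - 1 = k - 1 - 1 by ring, zpow_sub_one₀ h1]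
        ring_nf
      rw [if_pos (show 0 < 1 + k by omega), if_pos hk, if_neg hk.ne', e1, e2]
      push_cast
      split_ifs with h
      · ring
      · obtain rfl : k = 1 := by omega
        norm_num
  exact LinearMap.congr_fun h p

theorem derivFunctional_toLaurent (p : Polynomial K) :
    derivFunctional K (Polynomial.toLaurent p) = p.derivative.eval (-1) := by
  induction p using Polynomial.induction_on' with
  | add p q hp hq => simp [hp, hq]
  | monomial n a =>
    rw [← Polynomial.C_mul_X_pow_eq_monomial, Polynomial.toLaurent_C_mul_X_pow, ← smul_eq_C_mul,
      map_smul, derivFunctional_T]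
    cases n with
    | zero => simp
    | succ n =>
      simp
      exact Or.inl (mul_comm _ _)

theorem derivFunctional_eval₂ (p : Polynomial K) :
    derivFunctional K (p.eval₂ C (T (-1))) = 0 := by
  induction p using Polynomial.induction_on' with
  | add p q hp hq => simp [Polynomial.eval₂_add, hp, hq]
  | monomial n a =>
    rw [Polynomial.eval₂_monomial, T_pow, ← smul_eq_C_mul, map_smul, derivFunctional_T,
      if_neg (by simp), smul_zero]

end LaurentPolynomial

end CoefficientFunctional

section Evaluation

open PowerSeries LaurentPolynomial

variable {K : Type*} [Field K]

/-- Substitution of the Laurent variable, coefficientwise. -/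
noncomputable def evalT (K : Type*) [Field K] : (Polynomial K)⟦X⟧ →+* K[T;T⁻¹]⟦X⟧ :=
  PowerSeries.map Polynomial.toLaurent

/-- Substitution of the inverse of the Laurent variable, coefficientwise. -/
noncomputable def evalTInv (K : Type*) [Field K] : (Polynomial K)⟦X⟧ →+* K[T;T⁻¹]⟦X⟧ :=
  PowerSeries.map (Polynomial.eval₂RingHom LaurentPolynomial.C (T (-1)))

/-- Substitution of a power series for the polynomial variable. -/
noncomputable def evalSeries (Z : K[T;T⁻¹]⟦X⟧) : (Polynomial K)⟦X⟧ →+* K[T;T⁻¹]⟦X⟧ :=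
  PowerSeries.diag.comp (PowerSeries.map
    (Polynomial.eval₂RingHom (PowerSeries.C.comp LaurentPolynomial.C) Z))

theorem evalT_map (c : K⟦X⟧) :
    evalT K (PowerSeries.map Polynomial.C c) = PowerSeries.map LaurentPolynomial.C c := by
  rw [evalT, ← RingHom.comp_apply, ← PowerSeries.map_comp]
  congr 2
  ext1 r
  simp

theorem evalTInv_map (c : K⟦X⟧) :
    evalTInv K (PowerSeries.map Polynomial.C c) = PowerSeries.map LaurentPolynomial.C c := by
  rw [evalTInv, ← RingHom.comp_apply, ← PowerSeries.map_comp]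
  congr 2
  ext1 r
  simp

theorem evalSeries_map (Z : K[T;T⁻¹]⟦X⟧) (c : K⟦X⟧) :
    evalSeries Z (PowerSeries.map Polynomial.C c) = PowerSeries.map LaurentPolynomial.C c := by
  rw [evalSeries, RingHom.comp_apply, ← RingHom.comp_apply (PowerSeries.map _),
    ← PowerSeries.map_comp]
  have : (Polynomial.eval₂RingHom (PowerSeries.C.comp LaurentPolynomial.C) Z).comp Polynomial.C =
      PowerSeries.C.comp (LaurentPolynomial.C (R := K)) := by
    ext1 r
    simp
  rw [this, PowerSeries.map_comp, RingHom.comp_apply, diag_map_C]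

theorem evalT_C_X : evalT K (PowerSeries.C Polynomial.X) = PowerSeries.C (T 1) := by
  simp [evalT]

theorem evalTInv_C_X : evalTInv K (PowerSeries.C Polynomial.X) = PowerSeries.C (T (-1)) := by
  simp [evalTInv]

theorem evalSeries_C_X (Z : K[T;T⁻¹]⟦X⟧) : evalSeries Z (PowerSeries.C Polynomial.X) = Z := by
  simp [evalSeries]

theorem evalT_eq_diag (p : (Polynomial K)⟦X⟧) :
    evalT K p = PowerSeries.diag
      (PowerSeries.map (PowerSeries.C.comp Polynomial.toLaurent) p) := by
  rw [PowerSeries.map_comp, RingHom.comp_apply, diag_map_C, evalT]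

theorem mapFunctional_derivFunctional_evalT (p : (Polynomial K)⟦X⟧) :
    mapFunctional (derivFunctional K) (evalT K (PowerSeries.C (1 + Polynomial.X) * p)) =
      PowerSeries.map (Polynomial.evalRingHom (-1)) p := by
  ext n
  rw [coeff_mapFunctional, evalT, PowerSeries.coeff_map, PowerSeries.coeff_map,
    PowerSeries.coeff_C_mul, derivFunctional_toLaurent]
  simp

theorem mapFunctional_derivFunctional_evalTInv (p : (Polynomial K)⟦X⟧) :
    mapFunctional (derivFunctional K) (evalTInv K p) = 0 := by
  ext n
  rw [coeff_mapFunctional, evalTInv, PowerSeries.coeff_map, Polynomial.coe_eval₂RingHom,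
    derivFunctional_eval₂, map_zero]

theorem mapFunctional_derivFunctional_map (c : K⟦X⟧) :
    mapFunctional (derivFunctional K) (PowerSeries.map LaurentPolynomial.C c) = 0 := by
  have h := mapFunctional_map (derivFunctional K) c
  rw [← T_zero, derivFunctional_T, if_neg (lt_irrefl _), map_zero, mul_zero] at h
  exact h

theorem exists_C_X_mul {p : (Polynomial K)⟦X⟧}
    (h : PowerSeries.map (Polynomial.evalRingHom 0) p = 0) :
    ∃ p', p = PowerSeries.C Polynomial.X * p' := by
  refine ⟨.mk fun n => (PowerSeries.coeff n p).divX, ?_⟩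
  ext1 n
  have hn := congrArg (PowerSeries.coeff n) h
  rw [PowerSeries.coeff_map, map_zero, Polynomial.coe_evalRingHom,
    ← Polynomial.coeff_zero_eq_eval_zero] at hn
  have := Polynomial.divX_mul_X_add (PowerSeries.coeff n p)
  rw [hn, map_zero, add_zero] at this
  rw [PowerSeries.coeff_C_mul, PowerSeries.coeff_mk, mul_comm, this]

end Evaluation

section FunctionalEquation

open PowerSeries LaurentPolynomial

variable {K : Type*} [Field K] {E : ℕ → K[T;T⁻¹]⟦X⟧} {Z : K[T;T⁻¹]⟦X⟧}

theorem row_eq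
    (hE : ∀ k, E (k + 1) = (if k = 0 then 1 else 0) + X * PowerSeries.C (T 1 + 2 + T (-1)) *
      (E (k + 2) + 2 * E (k + 1) + E k))
    (hZ : Z = X * (PowerSeries.C (T 1 + 2 + T (-1)) * (1 + Z) ^ 2)) (k : ℕ) :
    E (k + 1) = Z ^ (k + 1) * E 0 + Z ^ k * (1 + Z) ^ 2 := by
  have hd : ∀ k, E (k + 1) - Z * E k = (if k = 0 then (1 + Z) ^ 2 else 0) +
      Z * (E (k + 2) - Z * E (k + 1)) := by
    intro k
    have := hE k
    split_ifs at this ⊢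
    · linear_combination (1 + Z) ^ 2 * this - (E (k + 2) + 2 * E (k + 1) + E k) * hZ
    · linear_combination (1 + Z) ^ 2 * this - (E (k + 2) + 2 * E (k + 1) + E k) * hZ
  have hX : X ∣ Z := ⟨_, hZ⟩
  have hdvd : ∀ N k : ℕ, X ^ N ∣ E (k + 2) - Z * E (k + 1) := by
    intro N
    induction N with
    | zero => simp
    | succ N ih =>
      intro k
      rw [hd (k + 1), if_neg k.succ_ne_zero, zero_add, pow_succ']
      exact mul_dvd_mul hX (ih (k + 1))
  have hz : ∀ k, E (k + 2) = Z * E (k + 1) := fun k =>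
    sub_eq_zero.1 (eq_zero_of_forall_X_pow_dvd fun N => hdvd N k)
  induction k with
  | zero =>
    have := hd 0
    rw [hz 0, if_pos rfl] at this
    linear_combination this
  | succ k ih => rw [hz k, ih]; ring

theorem constant_T_pow_mul (h1 : ∀ n k : ℕ, (PowerSeries.coeff n (E 0)).coeff (-(k + 1 : ℕ)) =
      (PowerSeries.coeff n (E (k + 1))).coeff 0) (k : ℕ) :
    mapFunctional (constantFunctional K) (PowerSeries.C (T (k + 1 : ℕ)) * E 0) =
      mapFunctional (constantFunctional K) (E (k + 1)) := by
  ext n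
  rw [coeff_mapFunctional, coeff_mapFunctional, PowerSeries.coeff_C_mul, constantFunctional_apply,
    constantFunctional_apply, coeff_T_mul, zero_sub, h1]

theorem pairing
    (hrow : ∀ k, E (k + 1) = Z ^ (k + 1) * E 0 + Z ^ k * (1 + Z) ^ 2)
    (h1 : ∀ n k : ℕ, (PowerSeries.coeff n (E 0)).coeff (-(k + 1 : ℕ)) =
      (PowerSeries.coeff n (E (k + 1))).coeff 0) (p : (Polynomial K)⟦X⟧) :
    mapFunctional (constantFunctional K) (evalT K (PowerSeries.C Polynomial.X * p) * E 0) =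
      mapFunctional (constantFunctional K)
        (Z * evalSeries Z p * E 0 + evalSeries Z p * (1 + Z) ^ 2) := by
  set l := constantFunctional K
  have key : ∀ c : Polynomial K,
      mapFunctional l (PowerSeries.C (Polynomial.toLaurent (Polynomial.X * c)) * E 0) =
      mapFunctional l (c.eval₂ (PowerSeries.C.comp LaurentPolynomial.C) Z *
        (Z * E 0 + (1 + Z) ^ 2)) := by
    intro c
    induction c using Polynomial.induction_on' with
    | add p q hp hq =>
      simp only [mul_add, map_add, add_mul, Polynomial.eval₂_add] at hp hq ⊢
      rw [hp, hq]
      ring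
    | monomial k a =>
      have e : PowerSeries.C (Polynomial.toLaurent (Polynomial.X * Polynomial.monomial k a)) * E 0 =
          PowerSeries.map (algebraMap K _) (PowerSeries.C a) *
            (PowerSeries.C (T (k + 1 : ℕ)) * E 0) := by
        rw [Polynomial.X_mul_monomial, ← Polynomial.C_mul_X_pow_eq_monomial,
          Polynomial.toLaurent_C_mul_X_pow, map_mul, PowerSeries.map_C, mul_assoc]
        rfl
      have e' : (Polynomial.monomial k a).eval₂ (PowerSeries.C.comp LaurentPolynomial.C) Z *
          (Z * E 0 + (1 + Z) ^ 2) =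
          PowerSeries.map (algebraMap K _) (PowerSeries.C a) * E (k + 1) := by
        rw [Polynomial.eval₂_monomial, PowerSeries.map_C, RingHom.comp_apply, hrow k,
          LaurentPolynomial.C_eq_algebraMap]
        ring
      rw [e, e', mapFunctional_map_mul, mapFunctional_map_mul, constant_T_pow_mul h1]
  have e1 : evalT K (PowerSeries.C Polynomial.X * p) * E 0 =
      diag (PowerSeries.map (PowerSeries.C.comp Polynomial.toLaurent)
        (PowerSeries.C Polynomial.X * p) * PowerSeries.C (E 0)) := by
    rw [map_mul diag, diag_C, ← evalT_eq_diag]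
  have e2 : Z * evalSeries Z p * E 0 + evalSeries Z p * (1 + Z) ^ 2 =
      diag (PowerSeries.map (Polynomial.eval₂RingHom (PowerSeries.C.comp LaurentPolynomial.C) Z) p *
        PowerSeries.C (Z * E 0 + (1 + Z) ^ 2)) := by
    rw [map_mul diag, diag_C, evalSeries, RingHom.comp_apply]
    ring
  rw [e1, e2]
  refine mapFunctional_diag_congr l fun i => ?_
  rw [PowerSeries.coeff_mul_C, PowerSeries.coeff_mul_C, PowerSeries.coeff_map,
    PowerSeries.coeff_map, PowerSeries.coeff_C_mul]
  exact key _

theorem constant_evalTInv_mul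
    (h0 : ∀ (n : ℕ) (m : ℤ), 0 ≤ m → (PowerSeries.coeff n (E 0)).coeff m = 0)
    (p : (Polynomial K)⟦X⟧) :
    mapFunctional (constantFunctional K) (evalTInv K p * E 0) = 0 := by
  have key : ∀ (c : Polynomial K) (n : ℕ),
      constantFunctional K (c.eval₂ LaurentPolynomial.C (T (-1)) * PowerSeries.coeff n (E 0)) =
        0 := by
    intro c n
    induction c using Polynomial.induction_on' with
    | add p q hp hq => rw [Polynomial.eval₂_add, add_mul, map_add, hp, hq, add_zero]
    | monomial k a =>
      rw [Polynomial.eval₂_monomial, T_pow, mul_assoc, ← LaurentPolynomial.smul_eq_C_mul, map_smul,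
        constantFunctional_apply, coeff_T_mul, h0 _ _ (by simp), smul_zero]
  ext n
  rw [coeff_mapFunctional, PowerSeries.coeff_mul, map_sum, map_zero]
  refine Finset.sum_eq_zero fun i _ => ?_
  rw [evalTInv, PowerSeries.coeff_map]
  exact key _ _

end FunctionalEquation

section Solution

open PowerSeries LaurentPolynomial KernelAlgebra

variable {K : Type*} [Field K] {E : ℕ → K[T;T⁻¹]⟦X⟧}

theorem KernelAlgebra.invariant_eq {R : Type*} [CommRing R] {κ r u m η : R}
    (h : η * (1 - κ * (u * m)) = 1) :
    invariant κ r (u * m) η = r * (κ - 1) +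
      u * (r * (-κ * (u * m ^ 2) + (1 - κ) * m + (1 - κ) * κ * m * η)) := by
  rw [invariant]
  linear_combination r * (1 - κ) * h

theorem KernelAlgebra.map_invariant {R S : Type*} [CommRing R] [CommRing S] (f : R →+* S)
    (κ r μ η : R) : f (invariant κ r μ η) = invariant (f κ) (f r) (f μ) (f η) := by
  simp [invariant]

theorem KernelAlgebra.eq_of_roots_of_fixedPoint {R : Type*} [CommRing R] [IsDomain R]
    {κ r σ x y Z w : R⟦X⟧} (hx : σ * (x - 1) = r * x ^ 2 * (1 - κ * x))
    (hy : σ * (y - 1) = r * y ^ 2 * (1 - κ * y)) (hxy : x ≠ y) (hr : r ≠ 0)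
    (hκ : X * r ^ 2 = κ) (hZ : Z = X * (σ * (1 + Z) ^ 2))
    (hw : (1 + Z) ^ 2 * (w - 1) = Z * r * w ^ 2 * (1 - κ * w)) : w * (1 - κ * (x + y)) = 1 := by
  obtain ⟨β, hβ⟩ := exists_mul_one_sub_X_mul_eq_one (r ^ 2 * (x + y))
  have hβ' : β * (1 - κ * (x + y)) = 1 := by
    rw [← hκ, mul_assoc]
    exact hβ
  have h1 : 1 + Z ≠ 0 := by
    rw [hZ]
    have := one_sub_X_mul_ne_zero (-(σ * (1 + Z) ^ 2))
    rwa [mul_neg, sub_neg_eq_add] at this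
  have e : w = 1 + X * (σ * r * (w ^ 2 * (1 - κ * w))) := by
    refine mul_left_cancel₀ (pow_ne_zero 2 h1) ?_
    linear_combination hw + r * w ^ 2 * (1 - κ * w) * hZ
  rw [eq_of_fixedPoint e (eq_of_inverse hx hy hxy hr hβ' hκ) (one_sub_X_mul_ne_zero _), hβ']

set_option maxHeartbeats 2000000 in
theorem constant_row_one
    (hE : ∀ k, E (k + 1) = (if k = 0 then 1 else 0) + X * PowerSeries.C (T 1 + 2 + T (-1)) *
      (E (k + 2) + 2 * E (k + 1) + E k))
    (h0 : ∀ (n : ℕ) (m : ℤ), 0 ≤ m → (PowerSeries.coeff n (E 0)).coeff m = 0)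
    (h1 : ∀ n k : ℕ, (PowerSeries.coeff n (E 0)).coeff (-(k + 1 : ℕ)) =
      (PowerSeries.coeff n (E (k + 1))).coeff 0) :
    ∃ g q κ ρ : K⟦X⟧, q ^ 2 = 1 - 4 * g ∧ constantCoeff q = 1 ∧
      X * (1 - 4 * g) = g * (1 - 3 * g) ^ 3 ∧ κ * (1 - 3 * g) = g * (1 - 4 * g) ∧
      ρ * (1 - 3 * g) = q ∧
      X * mapFunctional (constantFunctional K) (E 1) + 1 = (1 - κ ^ 2) * ρ := by
  obtain ⟨h, hh⟩ := exists_parametrization K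
  obtain ⟨i₃, hi₃⟩ := exists_mul_one_sub_X_mul_eq_one (3 * h)
  obtain ⟨i₄, hi₄⟩ := exists_mul_one_sub_X_mul_eq_one (4 * h)
  obtain ⟨n, hn⟩ := exists_mul_one_sub_eq (PowerSeries.map Polynomial.C h)
    (PowerSeries.C (1 + Polynomial.X))
  obtain ⟨j, hj⟩ := exists_mul_one_sub_X_mul_eq_one
    (PowerSeries.C (1 + Polynomial.X) * PowerSeries.map Polynomial.C h * n)
  obtain ⟨Z, hZ⟩ := exists_eq_X_mul_sq (PowerSeries.C (T 1 + 2 + T (-1) : K[T;T⁻¹]))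
  obtain ⟨g, hg⟩ : ∃ g, g = X * h := ⟨_, rfl⟩
  have hgS : X * PowerSeries.map Polynomial.C h = PowerSeries.map Polynomial.C g := by
    rw [hg, map_mul, PowerSeries.map_X]
  rw [← hg] at hh
  replace hi₃ : i₃ * (1 - 3 * g) = 1 := by rw [hg]; linear_combination hi₃
  replace hi₄ : i₄ * (1 - 4 * g) = 1 := by rw [hg]; linear_combination hi₄
  rw [hgS] at hn
  have hj' : j * (1 - PowerSeries.C (1 + Polynomial.X) * PowerSeries.map Polynomial.C g * n) =
      1 := by
    rw [← hgS]
    linear_combination hj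
  obtain ⟨κ, hκ⟩ : ∃ κ, κ = g * (1 - 4 * g) * i₃ := ⟨_, rfl⟩
  obtain ⟨r, hr⟩ : ∃ r, r = (1 - 4 * g) * i₃ ^ 2 := ⟨_, rfl⟩
  have hκ' : κ * (1 - 3 * g) = g * (1 - 4 * g) := by
    rw [hκ]; linear_combination g * (1 - 4 * g) * hi₃
  have hr' : r * (1 - 3 * g) ^ 2 = 1 - 4 * g := by
    rw [hr]; linear_combination (1 - 4 * g) * (i₃ * (1 - 3 * g) + 1) * hi₃
  have hne₃ : 1 - 3 * g ≠ 0 := right_ne_zero_of_mul_eq_one hi₃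
  have hne₄ : 1 - 4 * g ≠ 0 := right_ne_zero_of_mul_eq_one hi₄
  have hXr : X * r ^ 2 = κ := by
    refine mul_left_cancel₀ (pow_ne_zero 4 hne₃) ?_
    linear_combination X * (r * (1 - 3 * g) ^ 2 + 1 - 4 * g) * hr' + (1 - 4 * g) * hh -
      (1 - 3 * g) ^ 3 * hκ'
  obtain ⟨ι, hι⟩ : ∃ ι : K⟦X⟧ →+* (Polynomial K)⟦X⟧, ι = PowerSeries.map Polynomial.C := ⟨_, rfl⟩
  obtain ⟨u, hu⟩ : ∃ u : (Polynomial K)⟦X⟧, u = PowerSeries.C (1 + Polynomial.X) := ⟨_, rfl⟩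
  rw [← hι, ← hu] at hn hj'
  obtain ⟨m, hm⟩ : ∃ m, m = (1 - 2 * ι g * n) * (1 - 3 * ι g) * ι i₄ * j := ⟨_, rfl⟩
  have si₃ : ι i₃ * (1 - 3 * ι g) = 1 := by
    simpa only [map_mul, map_sub, map_one, map_ofNat, map_pow] using congrArg ι hi₃
  have si₄ : ι i₄ * (1 - 4 * ι g) = 1 := by
    simpa only [map_mul, map_sub, map_one, map_ofNat, map_pow] using congrArg ι hi₄
  have sκ : ι κ * (1 - 3 * ι g) = ι g * (1 - 4 * ι g) := by
    simpa only [map_mul, map_sub, map_one, map_ofNat, map_pow] using congrArg ι hκ'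
  have sr : ι r * (1 - 3 * ι g) ^ 2 = 1 - 4 * ι g := by
    simpa only [map_mul, map_sub, map_one, map_ofNat, map_pow] using congrArg ι hr'
  have sne₃ := right_ne_zero_of_mul_eq_one si₃
  have sne₄ := right_ne_zero_of_mul_eq_one si₄
  have sne := right_ne_zero_of_mul_eq_one hj'
  have hm' : m * ((1 - 4 * ι g) * (1 - u * ι g * n)) = (1 - 2 * ι g * n) * (1 - 3 * ι g) := by
    rw [hm]
    linear_combination (1 - 2 * ι g * n) * (1 - 3 * ι g) *
      (j * (1 - u * ι g * n) * si₄ + hj')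
  have hη := mul_one_sub_eq_one hn hm' sκ sne₃ sne₄ sne
  have hcub := cubic_of_parametrization hn hm' sκ sr sne₃ sne₄ sne
  obtain ⟨η, hη'⟩ : ∃ η, η = n * (1 - ι g * n) := ⟨_, rfl⟩
  rw [← hη'] at hη
  obtain ⟨φ, hφ⟩ : ∃ φ, φ = invariant (ι κ) (ι r) (u * m) η := ⟨_, rfl⟩
  obtain ⟨t, ht⟩ : ∃ t, t = ι r * (-ι κ * (u * m ^ 2) + (1 - ι κ) * m +
    (1 - ι κ) * ι κ * m * η) := ⟨_, rfl⟩
  have hφt : φ = ι (r * (κ - 1)) + u * t := by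
    rw [hφ, invariant_eq hη, ht]
    simp
  obtain ⟨φ', hφ'⟩ : ∃ φ', φ = PowerSeries.C Polynomial.X * φ' := by
    refine exists_C_X_mul ?_
    obtain ⟨ε, hε⟩ : ∃ ε : (Polynomial K)⟦X⟧ →+* K⟦X⟧,
      ε = PowerSeries.map (Polynomial.evalRingHom 0) := ⟨_, rfl⟩
    have hε' : ∀ c, ε (ι c) = c := by
      intro c
      ext k
      simp [hε, hι]
    have hεu : ε u = 1 := by simp [hε, hu]
    have hc := congrArg ε hcub
    have he := congrArg ε hη
    simp only [map_mul, map_pow, map_sub, map_one, hε', hεu] at hc he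
    rw [← hε, hφ, map_invariant, map_mul, hε', hε', hεu, invariant]
    have hc' : ε m = 1 := by linear_combination hc
    rw [hc'] at he ⊢
    linear_combination r * he
  obtain ⟨δ, hδ⟩ : ∃ δ : (Polynomial K)⟦X⟧ →+* K⟦X⟧,
    δ = PowerSeries.map (Polynomial.evalRingHom (-1)) := ⟨_, rfl⟩
  have hδ' : ∀ c, δ (ι c) = c := by
    intro c
    ext k
    simp [hδ, hι]
  have hδu : δ u = 0 := by simp [hδ, hu]
  have hδn : δ n * (1 - g * δ n) = 1 := by
    have := congrArg δ hn
    simpa only [map_mul, map_sub, map_one, hδ', hδu, zero_mul, sub_zero, mul_one] using this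
  have hδm : δ m * (1 - 4 * g) = (1 - 2 * g * δ n) * (1 - 3 * g) := by
    have := congrArg δ hm'
    simpa only [map_mul, map_sub, map_one, map_ofNat, hδ', hδu, zero_mul, sub_zero,
      mul_one] using this
  have hδη : δ η = 1 := by rw [hη', map_mul, map_sub, map_mul, map_one, hδ', hδn]
  have hδt : δ t = (1 - κ ^ 2) * ((1 - 2 * g * δ n) * i₃) := by
    have h2 : r * δ m * (1 - 3 * g) = 1 - 2 * g * δ n := by
      refine mul_left_cancel₀ (mul_ne_zero hne₃ hne₄) ?_
      linear_combination (1 - 4 * g) * δ m * hr' + (1 - 4 * g) * hδm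
    rw [ht]
    simp only [map_mul, map_add, map_sub, map_neg, map_one, map_pow, hδ', hδu, hδη]
    linear_combination (1 - κ ^ 2) * i₃ * h2 - (1 - κ ^ 2) * r * δ m * hi₃
  obtain ⟨ιA, hιA⟩ : ∃ ιA : K⟦X⟧ →+* K[T;T⁻¹]⟦X⟧,
    ιA = PowerSeries.map LaurentPolynomial.C := ⟨_, rfl⟩
  have hF : ∀ F : (Polynomial K)⟦X⟧ →+* K[T;T⁻¹]⟦X⟧, (∀ c, F (ι c) = ιA c) →
      (F u) ^ 2 * (F (u * m) - 1) = (F u - 1) * ιA r * F (u * m) ^ 2 * (1 - ιA κ * F (u * m)) ∧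
      F η * (1 - ιA κ * F (u * m)) = 1 ∧ F φ = invariant (ιA κ) (ιA r) (F (u * m)) (F η) := by
    intro F hFι
    refine ⟨?_, ?_, ?_⟩
    · have := congrArg F hcub
      simpa only [map_mul F (_ ^ 2), map_mul F (_ * _ ^ 2), map_mul F (_ * ι r) (_ ^ 2),
        map_mul F _ (ι r), map_pow, map_sub, map_one, hFι, map_mul F (ι κ),
        map_mul F (_ * _) (_ - _)] using this
    · have := congrArg F hη
      simpa only [map_mul F η, map_sub, map_one, map_mul F (ι κ), hFι] using this
    · rw [hφ, map_invariant, hFι, hFι]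
  obtain ⟨F₁, hF₁⟩ : ∃ F, F = evalT K := ⟨_, rfl⟩
  obtain ⟨F₂, hF₂⟩ : ∃ F, F = evalTInv K := ⟨_, rfl⟩
  obtain ⟨F₃, hF₃⟩ : ∃ F, F = evalSeries Z := ⟨_, rfl⟩
  have f₁ : ∀ c, F₁ (ι c) = ιA c := by rw [hF₁, hι, hιA]; exact evalT_map
  have f₂ : ∀ c, F₂ (ι c) = ιA c := by rw [hF₂, hι, hιA]; exact evalTInv_map
  have f₃ : ∀ c, F₃ (ι c) = ιA c := by rw [hF₃, hι, hιA]; exact evalSeries_map Z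
  obtain ⟨cub₁, η₁, φ₁⟩ := hF F₁ f₁
  obtain ⟨cub₂, η₂, φ₂⟩ := hF F₂ f₂
  obtain ⟨cub₃, η₃, φ₃⟩ := hF F₃ f₃
  have u₁ : F₁ u = 1 + PowerSeries.C (T 1) := by
    rw [hu, map_add, map_add, map_one, map_one, hF₁, evalT_C_X]
  have u₂ : F₂ u = 1 + PowerSeries.C (T (-1)) := by
    rw [hu, map_add, map_add, map_one, map_one, hF₂, evalTInv_C_X]
  have u₃ : F₃ u = 1 + Z := by
    rw [hu, map_add, map_add, map_one, map_one, hF₃, evalSeries_C_X]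
  have hTT : PowerSeries.C (T 1 : K[T;T⁻¹]) * PowerSeries.C (T (-1)) = 1 := by
    rw [← map_mul, ← T_add, add_neg_cancel, T_zero, map_one]
  have hσ : PowerSeries.C (T 1 + 2 + T (-1) : K[T;T⁻¹]) =
      PowerSeries.C (T 1) + 2 + PowerSeries.C (T (-1)) := by
    rw [map_add, map_add, map_ofNat]
  have cub₁' : PowerSeries.C (T 1 + 2 + T (-1)) * (F₁ (u * m) - 1) =
      ιA r * F₁ (u * m) ^ 2 * (1 - ιA κ * F₁ (u * m)) := by
    rw [u₁] at cub₁
    rw [hσ]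
    linear_combination PowerSeries.C (T (-1)) * cub₁ + (ιA r * F₁ (u * m) ^ 2 *
      (1 - ιA κ * F₁ (u * m)) - (2 + PowerSeries.C (T 1)) * (F₁ (u * m) - 1)) * hTT
  have cub₂' : PowerSeries.C (T 1 + 2 + T (-1)) * (F₂ (u * m) - 1) =
      ιA r * F₂ (u * m) ^ 2 * (1 - ιA κ * F₂ (u * m)) := by
    rw [u₂] at cub₂
    rw [hσ]
    linear_combination PowerSeries.C (T 1) * cub₂ + (ιA r * F₂ (u * m) ^ 2 *
      (1 - ιA κ * F₂ (u * m)) - (2 + PowerSeries.C (T (-1))) * (F₂ (u * m) - 1)) * hTT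
  have hconst : constantCoeff m = 1 := by
    have hgc : constantCoeff (ι g) = 0 := by rw [hι, ← hgS]; simp
    have := congrArg constantCoeff hm'
    simpa only [map_mul, map_sub, map_one, hgc, mul_zero, zero_mul, sub_zero, mul_one] using this
  have hne : F₁ (u * m) ≠ F₂ (u * m) := by
    intro heq
    have hum : PowerSeries.coeff 0 (u * m) = 1 + Polynomial.X := by
      rw [PowerSeries.coeff_zero_eq_constantCoeff, map_mul, hconst, hu]
      simp
    have := congrArg (PowerSeries.coeff 0) heq
    rw [hF₁, hF₂, evalT, evalTInv, PowerSeries.coeff_map, PowerSeries.coeff_map, hum] at this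
    rw [map_add, map_add, map_one, map_one, Polynomial.toLaurent_X, Polynomial.coe_eval₂RingHom,
      Polynomial.eval₂_X, add_right_inj] at this
    have := congrArg (fun p : K[T;T⁻¹] => p.coeff 1) this
    simp only [T, AddMonoidAlgebra.coeff_single, Finsupp.single_apply] at this
    norm_num at this
  have hrA : ιA r ≠ 0 := by
    intro h2
    have h3 := congrArg ιA hr'
    have h4 := congrArg ιA hi₄
    rw [map_mul, h2, zero_mul] at h3
    rw [map_mul, ← h3, mul_zero, map_one] at h4
    exact zero_ne_one h4
  have hXrA : X * ιA r ^ 2 = ιA κ := by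
    rw [← hXr, map_mul, map_pow, hιA, PowerSeries.map_X]
  have hw := eq_of_roots_of_fixedPoint cub₁' cub₂' hne hrA hXrA hZ
    (by simpa only [u₃, add_sub_cancel_left] using cub₃)
  have hsum : F₁ φ + F₂ φ - F₃ φ = PowerSeries.C (T 1) + PowerSeries.C (T (-1)) +
      ιA (2 - 2 * r * (1 - κ)) := by
    rw [φ₁, φ₂, φ₃, invariant_relation cub₁' cub₂' hne hrA hw η₁ η₂ η₃, hσ]
    simp only [map_mul, map_sub, map_one, map_ofNat]
    ring
  have hrow := row_eq hE hZ
  have hpair := pairing hrow h1 φ'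
  rw [← hφ', ← hF₁, ← hF₃] at hpair
  have hφ₃ : F₃ φ = Z * F₃ φ' := by rw [hφ', map_mul, hF₃, evalSeries_C_X]
  rw [← hφ₃] at hpair
  set l := mapFunctional (constantFunctional K)
  have hG : l (F₃ φ' * (1 + Z) ^ 2) = l (E 1) := by
    have a1 : l (F₂ φ * E 0) = 0 := by rw [hF₂]; exact constant_evalTInv_mul h0 φ
    have a2 : l (ιA (2 - 2 * r * (1 - κ)) * E 0) = 0 := by
      rw [hιA, ← evalTInv_map]; exact constant_evalTInv_mul h0 _
    have a3 : l (PowerSeries.C (T (-1)) * E 0) = 0 := by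
      rw [← evalTInv_C_X]; exact constant_evalTInv_mul h0 _
    have a4 : l (PowerSeries.C (T 1) * E 0) = l (E 1) := constant_T_pow_mul h1 0
    have a5 : l (F₁ φ * E 0) + l (F₂ φ * E 0) = l (F₃ φ * E 0) + l (PowerSeries.C (T 1) * E 0) +
        l (PowerSeries.C (T (-1)) * E 0) + l (ιA (2 - 2 * r * (1 - κ)) * E 0) := by
      simp only [← map_add]
      congr 1
      linear_combination E 0 * hsum
    rw [map_add] at hpair
    rw [hpair, a1, a2, a3, a4] at a5
    linear_combination a5
  set d := mapFunctional (derivFunctional K)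
  have hd : d (F₃ φ) = X * l (E 1) := by
    have : F₃ φ = X * (PowerSeries.C (T 1 + 2 + T (-1)) * (F₃ φ' * (1 + Z) ^ 2)) := by
      linear_combination hφ₃ + F₃ φ' * hZ
    rw [this, mapFunctional_X_mul, ← hG]
    congr 1
    ext k
    rw [coeff_mapFunctional, coeff_mapFunctional, PowerSeries.coeff_C_mul, derivFunctional_mul,
      constantFunctional_apply]
  have hfinal : X * l (E 1) + 1 = (1 - κ ^ 2) * ((1 - 2 * g * δ n) * i₃) := by
    have b1 : d (F₁ φ) = (1 - κ ^ 2) * ((1 - 2 * g * δ n) * i₃) := by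
      rw [hφt, map_add, f₁, map_add, hιA, mapFunctional_derivFunctional_map, zero_add, hF₁, hu,
        mapFunctional_derivFunctional_evalT, ← hδ, hδt]
    have b2 : d (F₂ φ) = 0 := by rw [hF₂]; exact mapFunctional_derivFunctional_evalTInv φ
    have b3 : d (PowerSeries.C (T 1)) = 1 := by
      ext k
      rw [coeff_mapFunctional, PowerSeries.coeff_C, PowerSeries.coeff_one]
      split_ifs
      · simp [derivFunctional_T]
      · simp
    have b4 : d (PowerSeries.C (T (-1))) = 0 := by
      rw [← evalTInv_C_X]; exact mapFunctional_derivFunctional_evalTInv _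
    have b5 : d (ιA (2 - 2 * r * (1 - κ))) = 0 := by
      rw [hιA]; exact mapFunctional_derivFunctional_map _
    have b6 := congrArg d hsum
    rw [map_sub, map_add, map_add, map_add, b1, b2, b3, b4, b5, hd] at b6
    linear_combination -b6
  refine ⟨g, 1 - 2 * g * δ n, κ, (1 - 2 * g * δ n) * i₃, ?_, ?_, hh, hκ', ?_, hfinal⟩
  · linear_combination -4 * g * hδn
  · rw [hg]
    simp
  · linear_combination (1 - 2 * g * δ n) * hi₃

end Solution

namespace KernelAlgebra

section Derivation

variable {k A : Type*} [CommRing k] [CommRing A] [Algebra k A] (D : Derivation k A A)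

theorem derivation_numeral_mul (n : ℕ) [n.AtLeastTwo] (a : A) :
    D ((OfNat.ofNat n : A) * a) = OfNat.ofNat n * D a := by
  rw [D.leibniz, ← Nat.cast_ofNat, D.map_natCast, smul_zero, add_zero, smul_eq_mul]

theorem derivation_sub_numeral (n : ℕ) [n.AtLeastTwo] (a : A) :
    D (a - (OfNat.ofNat n : A)) = D a := by
  rw [map_sub, ← Nat.cast_ofNat, D.map_natCast, sub_zero]

theorem derivation_mul (a b : A) : D (a * b) = a * D b + b * D a := by
  rw [D.leibniz, smul_eq_mul, smul_eq_mul]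

theorem derivation_pow_succ (a : A) (n : ℕ) : D (a ^ (n + 1)) = (n + 1) * a ^ n * D a := by
  rw [D.leibniz_pow, smul_eq_mul, nsmul_eq_mul, Nat.add_sub_cancel]
  push_cast
  ring

variable [IsDomain A] {z s P : A}

theorem derivation_of_parametrization (hD : D z = z) (hz : 256 * z * (P - 1) = (4 - P) * P ^ 3)
    (hP : P ≠ 0) :
    3 * (P - 2) ^ 2 * D P = P * (P - 1) * (P - 4) := by
  have h := congrArg D hz
  rw [← neg_sub P 4, neg_mul, map_neg, derivation_mul, derivation_numeral_mul, derivation_mul,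
    derivation_pow_succ, derivation_sub_numeral, hD, map_sub, D.map_one_eq_zero] at h
  push_cast at h
  refine mul_left_cancel₀ (pow_ne_zero 2 hP) ?_
  linear_combination (P - 1) * h - (D P + P - 1) * hz

variable [CharZero A]

theorem derivation_of_sq {q : A} (hP : 3 * (P - 2) ^ 2 * D P = P * (P - 1) * (P - 4))
    (hq : 3 * q ^ 2 = P - 1) (hq0 : q ≠ 0) : 6 * (P - 2) ^ 2 * D q = q * P * (P - 4) := by
  have h := congrArg D hq
  rw [derivation_numeral_mul, derivation_pow_succ, map_sub, D.map_one_eq_zero] at h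
  push_cast at h
  refine mul_left_cancel₀ (mul_ne_zero (by norm_num : (3 : A) ≠ 0) hq0) ?_
  linear_combination 3 * (P - 2) ^ 2 * h + hP - P * (P - 4) * hq

theorem second_order_ratio {f : A} (hz : 256 * z * (P - 1) = (4 - P) * P ^ 3) (hP1 : P - 1 ≠ 0)
    (hP : 3 * (P - 2) ^ 2 * D P = P * (P - 1) * (P - 4))
    (hf : 6 * (P - 2) * D f = f * (4 - P)) :
    12 * D (D f) + 4 * D f = 16 * z * (12 * D (D f) + 8 * D f + f) := by
  have h := congrArg D hf
  rw [← neg_sub P 4, mul_neg, map_neg, mul_assoc, derivation_numeral_mul, derivation_mul,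
    derivation_mul, derivation_sub_numeral, derivation_sub_numeral] at h
  refine mul_left_cancel₀ (mul_ne_zero (by norm_num : (48 : A) ≠ 0) hP1) ?_
  linear_combination 6 * (P - 2) ^ 2 * (P + 2) * h - 2 * (P + 2) * (6 * D f + f) * hP +
    P * (P ^ 2 - 2 * P + 4) * hf - 3 * (12 * D (D f) + 8 * D f + f) * hz

theorem second_order_root {f : A} (hz : 256 * z * (P - 1) = (4 - P) * P ^ 3) (hP1 : P - 1 ≠ 0)
    (hP : 3 * (P - 2) ^ 2 * D P = P * (P - 1) * (P - 4))
    (hf : 6 * (P - 2) ^ 2 * D f = f * P * (P - 4)) :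
    12 * D (D f) - 4 * D f = 16 * z * (12 * D (D f) + 4 * D f - f) := by
  have h := congrArg D hf
  rw [mul_assoc, derivation_numeral_mul, derivation_mul, derivation_pow_succ, derivation_mul,
    derivation_mul, derivation_sub_numeral, derivation_sub_numeral] at h
  push_cast at h
  refine mul_left_cancel₀ (mul_ne_zero (by norm_num : (48 : A) ≠ 0) hP1) ?_
  linear_combination 6 * (P - 2) * (P + 2) * h - 4 * (P + 2) * (6 * D f - f) * hP -
    (P ^ 2 + 4 * P - 8) * hf - 3 * (12 * D (D f) + 4 * D f - f) * hz

omit [CharZero A] in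
theorem derivation_mul_pow (hP0 : P ≠ 0) (hP : 3 * (P - 2) ^ 2 * D P = P * (P - 1) * (P - 4))
    (hs : 6 * (P - 2) ^ 2 * D (s * P ^ 3) = s * P ^ 3 * P * (P - 4)) (n : ℕ) :
    6 * (P - 2) ^ 2 * D (s * P ^ (n + 1)) =
      s * P ^ (n + 1) * ((P - 4) * (6 - 5 * P + 2 * (n + 1) * (P - 1))) := by
  rw [derivation_mul, derivation_pow_succ] at hs ⊢
  push_cast at hs
  refine mul_left_cancel₀ (pow_ne_zero 2 hP0) ?_
  linear_combination P ^ n * hs + 2 * s * P ^ (n + 2) * (n - 2) * hP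

variable (hP2 : P - 2 ≠ 0)
  (hs : ∀ n : ℕ, 6 * (P - 2) ^ 2 * D (s * P ^ (n + 1)) =
    s * P ^ (n + 1) * ((P - 4) * (6 - 5 * P + 2 * (n + 1) * (P - 1))))

include hP2 hs

omit [CharZero A] in
theorem derivation_ratio :
    6 * (P - 2) * D (4 * (s * P ^ 2)) = 4 * (s * P ^ 2) * (4 - P) := by
  rw [derivation_numeral_mul]
  refine mul_left_cancel₀ hP2 ?_
  have := hs 1
  push_cast at this
  linear_combination 4 * this

omit [CharZero A] in
theorem derivation_div_sq :
    6 * D (s * P ^ 3) - s * P ^ 3 + 24 * D (s * P) + 16 * (s * P) = 0 := by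
  refine mul_left_cancel₀ (pow_ne_zero 2 hP2) ?_
  have h0 := hs 0
  have h2 := hs 2
  rw [zero_add, pow_one] at h0
  push_cast at h0 h2
  linear_combination h2 + 4 * h0

theorem derivation_mul_self :
    2 * D (s * P ^ 4 - 4 * (s * P ^ 3) + 12 * (s * P ^ 2)) =
      s * P ^ 4 - 4 * (s * P ^ 3) + 12 * (s * P ^ 2) + 2 * (s * P ^ 3 - 10 * (s * P ^ 2)) := by
  rw [map_add, map_sub, derivation_numeral_mul, derivation_numeral_mul]
  refine mul_left_cancel₀ (mul_ne_zero (by norm_num : (3 : A) ≠ 0) (pow_ne_zero 2 hP2)) ?_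
  have h1 := hs 1
  have h2 := hs 2
  have h3 := hs 3
  push_cast at h1 h2 h3
  linear_combination h3 - 4 * h2 + 12 * h1

theorem derivation_remainder (hP0 : P ≠ 0) (hP : 3 * (P - 2) ^ 2 * D P = P * (P - 1) * (P - 4)) :
    2 * D (s * (P ^ 4 - 10 * P ^ 3 + 24 * P ^ 2 - 40 * P + 16)) +
      2 * (s * (P ^ 4 - 10 * P ^ 3 + 24 * P ^ 2 - 40 * P + 16)) =
      3 * (s * P ^ 4) - 24 * (s * P ^ 3) + 36 * (s * P ^ 2) - 24 * (s * P) := by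
  have e : s * (P ^ 4 - 10 * P ^ 3 + 24 * P ^ 2 - 40 * P + 16) =
      s * P ^ 4 - 10 * (s * P ^ 3) + 24 * (s * P ^ 2) - 40 * (s * P) + 16 * s := by ring
  rw [e, map_add, map_sub, map_add, map_sub, derivation_numeral_mul, derivation_numeral_mul,
    derivation_numeral_mul, derivation_numeral_mul]
  have h0 := hs 0
  have h1 := hs 1
  have h2 := hs 2
  have h3 := hs 3
  rw [zero_add, pow_one] at h0
  push_cast at h0 h1 h2 h3
  have h := h0
  rw [derivation_mul] at h
  have hs0 : 6 * (P - 2) ^ 2 * D s = s * ((P - 4) * (6 - 5 * P)) := by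
    refine mul_left_cancel₀ hP0 ?_
    linear_combination h - 2 * s * hP
  refine mul_left_cancel₀ (mul_ne_zero (by norm_num : (3 : A) ≠ 0) (pow_ne_zero 2 hP2)) ?_
  linear_combination h3 - 10 * h2 + 24 * h1 - 40 * h0 + 16 * hs0

end Derivation

end KernelAlgebra

section Coefficients

open PowerSeries KernelAlgebra

/-- The Euler operator `X d/dX`. -/
noncomputable def PowerSeries.euler : Derivation ℚ ℚ⟦X⟧ ℚ⟦X⟧ := (X : ℚ⟦X⟧) • d⁄dX ℚ

theorem PowerSeries.coeff_euler (f : ℚ⟦X⟧) (n : ℕ) :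
    coeff n (euler f) = n * coeff n f := by
  rw [euler, Derivation.smul_apply, smul_eq_mul]
  cases n with
  | zero => simp
  | succ n =>
    rw [coeff_succ_X_mul, coeff_derivative]
    push_cast
    ring

theorem PowerSeries.euler_X : euler X = X := by
  rw [euler, Derivation.smul_apply, derivative_X, smul_eq_mul, mul_one]

theorem PowerSeries.coeff_numeral_mul (n m : ℕ) [m.AtLeastTwo] (f : ℚ⟦X⟧) :
    coeff n ((ofNat(m) : ℚ⟦X⟧) * f) = ofNat(m) * coeff n f := by
  rw [← map_ofNat (C (R := ℚ)), coeff_C_mul]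

theorem exists_coefficient_sequences {g q κ ρ F : ℚ⟦X⟧} (hq : q ^ 2 = 1 - 4 * g)
    (hq0 : constantCoeff q = 1) (hg : X * (1 - 4 * g) = g * (1 - 3 * g) ^ 3)
    (hκ : κ * (1 - 3 * g) = g * (1 - 4 * g)) (hρ : ρ * (1 - 3 * g) = q)
    (hF : X * F + 1 = (1 - κ ^ 2) * ρ) :
    ∃ a y R : ℕ → ℚ, a 0 = 1 ∧
      (∀ n : ℕ, a (n + 1) * ((4 / 3 + n) * (1 + n)) = 16 * (a n * ((1 / 2 + n) * (1 / 6 + n)))) ∧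
      y 0 = 1 ∧
      (∀ n : ℕ, y (n + 1) * ((2 / 3 + n) * (1 + n)) =
        16 * (y n * ((1 / 2 + n) * (-1 / 6 + n)))) ∧
      (∀ n : ℕ, (n + 1) * |R n| ≤ 33 * (|y n| + |a n|)) ∧
      ∀ n, 81 * coeff n F = 72 * a (n + 1) - 4 * R (n + 1) := by
  have : CharZero ℚ⟦X⟧ := algebraRat.charZero _
  obtain ⟨P, hPg⟩ : ∃ P, P = 4 * (1 - 3 * g) := ⟨_, rfl⟩
  have hg0 : constantCoeff g = 0 := by
    have := congrArg constantCoeff hq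
    simp only [map_pow, map_sub, map_mul, map_one, map_ofNat, hq0] at this
    linarith
  have hPc : constantCoeff P = 4 := by
    rw [hPg, map_mul, map_sub, map_mul, hg0, map_one, map_ofNat]
    norm_num
  have hP0 : P ≠ 0 := fun h => by simp [h] at hPc
  have hP1 : P - 1 ≠ 0 := fun h => by
    rw [sub_eq_zero.mp h] at hPc
    norm_num at hPc
  have hP2 : P - 2 ≠ 0 := fun h => by
    rw [sub_eq_zero.mp h, map_ofNat] at hPc
    norm_num at hPc
  have hqn : q ≠ 0 := fun h => by simp [h] at hq0
  have hz : 256 * X * (P - 1) = (4 - P) * P ^ 3 := by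
    rw [hPg]
    linear_combination 768 * hg
  have hPq : 3 * q ^ 2 = P - 1 := by
    rw [hPg]
    linear_combination 3 * hq
  obtain ⟨s, hs⟩ : ∃ s, s * P ^ 3 = q := by
    have hi : P⁻¹ * P = 1 := PowerSeries.inv_mul_cancel P (by rw [hPc]; norm_num)
    refine ⟨q * P⁻¹ ^ 3, ?_⟩
    rw [mul_assoc, ← mul_pow, hi, one_pow, mul_one]
  have hρs : ρ = 4 * (s * P ^ 2) := by
    refine mul_right_cancel₀ hP0 ?_
    linear_combination 4 * hρ - 4 * hs + ρ * hPg
  have hDP := derivation_of_parametrization euler euler_X hz hP0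
  have hDq := derivation_of_sq euler hDP hPq hqn
  have hDs := derivation_mul_pow euler hP0 hDP (by rw [hs]; exact hDq)
  have e1 := second_order_ratio euler hz hP1 hDP (derivation_ratio euler hP2 hDs)
  have e2 := second_order_root euler hz hP1 hDP hDq
  have e3 := derivation_div_sq euler hP2 hDs
  have e4 := derivation_mul_self euler hP2 hDs
  have e5 := derivation_remainder euler hP2 hDs hP0 hDP
  rw [← hρs] at e1
  obtain ⟨R, hR⟩ : ∃ R, R = s * (P ^ 4 - 10 * P ^ 3 + 24 * P ^ 2 - 40 * P + 16) := ⟨_, rfl⟩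
  rw [← hR] at e5
  have hW : 81 * (X * F + 1) = 72 * ρ - 4 * R := by
    have hκP : 9 * (κ * P) = (4 - P) * (P - 1) := by
      rw [hPg]
      linear_combination 36 * hκ
    rw [hF, hρs, hR]
    linear_combination -4 * s * (9 * (κ * P) + (4 - P) * (P - 1)) * hκP
  refine ⟨fun n => coeff n ρ, fun n => coeff n q, fun n => coeff n R, ?_, ?_, ?_, ?_, ?_, ?_⟩
  · have := congrArg constantCoeff hρ
    simpa [hg0, hq0] using this
  · intro n
    have := congrArg (coeff (n + 1)) e1
    rw [mul_assoc, coeff_numeral_mul, coeff_succ_X_mul] at this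
    simp only [map_add, coeff_numeral_mul, coeff_euler] at this
    push_cast at this
    linear_combination this / 12
  · simpa using hq0
  · intro n
    have := congrArg (coeff (n + 1)) e2
    rw [mul_assoc, coeff_numeral_mul, coeff_succ_X_mul] at this
    simp only [map_add, map_sub, coeff_numeral_mul, coeff_euler] at this
    push_cast at this
    linear_combination this / 12
  · intro n
    have c3 := congrArg (coeff n) e3
    have c4 := congrArg (coeff n) e4
    have c5 := congrArg (coeff n) e5
    have cρ := congrArg (coeff n) hρs
    simp only [map_add, map_sub, map_zero, coeff_numeral_mul, coeff_euler] at c3 c4 c5 cρ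
    rw [hs] at c3 c4 c5
    beta_reduce
    rw [cρ]
    generalize coeff n (s * P) = b₁ at *
    generalize coeff n (s * P ^ 2) = b₂ at *
    generalize coeff n (s * P ^ 4) = b₄ at *
    generalize coeff n q = b₃ at *
    generalize coeff n R = r at *
    have hn : (0 : ℚ) ≤ n := n.cast_nonneg
    have k₁ : |b₁| ≤ |b₃| := by
      have h1 : (24 * n + 16) * |b₁| = |6 * (n : ℚ) - 1| * |b₃| := by
        rw [← abs_mul, ← abs_of_nonneg (by positivity : (0 : ℚ) ≤ 24 * n + 16), ← abs_mul,
          ← abs_neg]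
        congr 1
        linear_combination -c3
      have h2 : |6 * (n : ℚ) - 1| ≤ 24 * n + 16 := abs_le.mpr ⟨by linarith, by linarith⟩
      refine le_of_mul_le_mul_left ?_ (by positivity : (0 : ℚ) < 24 * n + 16)
      rw [h1]
      exact mul_le_mul_of_nonneg_right h2 (abs_nonneg _)
    have k₄ : |b₄| ≤ 6 * |b₃| + 32 * |b₂| := by
      have h1 : (1 : ℚ) ≤ |2 * (n : ℚ) - 1| := by
        have : (1 : ℤ) ≤ |2 * (n : ℤ) - 1| := Int.one_le_abs (by omega)
        exact_mod_cast this
      have h2 : |2 * (n : ℚ) - 1| * |b₄ - 4 * b₃ + 12 * b₂| = |2 * (b₃ - 10 * b₂)| := by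
        rw [← abs_mul]
        congr 1
        linear_combination c4
      have h3 : |b₄ - 4 * b₃ + 12 * b₂| ≤ |2 * (b₃ - 10 * b₂)| := by
        rw [← h2]
        exact le_mul_of_one_le_left (abs_nonneg _) h1
      grind
    have h5 : 2 * ((n + 1) * |r|) = |3 * b₄ - 24 * b₃ + 36 * b₂ - 24 * b₁| := by
      rw [← abs_of_nonneg (by positivity : (0 : ℚ) ≤ n + 1), ← abs_mul,
        ← abs_of_nonneg (by norm_num : (0 : ℚ) ≤ 2), ← abs_mul]
      congr 1
      linear_combination c5
    rw [abs_mul, abs_of_nonneg (by norm_num : (0 : ℚ) ≤ 4)]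
    have h6 : |3 * b₄ - 24 * b₃ + 36 * b₂ - 24 * b₁| ≤
        3 * |b₄| + 24 * |b₃| + 36 * |b₂| + 24 * |b₁| := by grind
    linarith [abs_nonneg b₂]
  · intro n
    have := congrArg (coeff (n + 1)) hW
    rw [coeff_numeral_mul, map_add, coeff_succ_X_mul, coeff_one, if_neg n.succ_ne_zero, add_zero,
      map_sub, coeff_numeral_mul, coeff_numeral_mul] at this
    exact this

end Coefficients

section Asymptotics

open Filter Topology Real

theorem tendsto_of_hypergeometric_recurrence {s : ℕ → ℝ} {a b c d x : ℝ} (hx : x ≠ 0)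
    (ha : ∀ n : ℕ, a + n ≠ 0) (hb : ∀ n : ℕ, b + n ≠ 0) (hc : ∀ n : ℕ, c + n ≠ 0)
    (hd : ∀ n : ℕ, d + n ≠ 0)
    (hs : ∀ n : ℕ, s (n + 1) * ((c + n) * (d + n)) = x * (s n * ((a + n) * (b + n)))) :
    Tendsto (fun n : ℕ => s (n + 1) / x ^ (n + 1) * (n : ℝ) ^ (c + d - a - b)) atTop
      (𝓝 (s 0 * (Gamma c * Gamma d / (Gamma a * Gamma b)))) := by
  have gne : ∀ t : ℝ, (∀ n : ℕ, t + n ≠ 0) → Gamma t ≠ 0 := fun t ht =>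
    Gamma_ne_zero fun m hm => ht m (by rw [hm, neg_add_cancel])
  have closed : ∀ n : ℕ, s n * ((∏ j ∈ Finset.range n, (c + j)) * ∏ j ∈ Finset.range n, (d + j)) =
      x ^ n * (s 0 * ((∏ j ∈ Finset.range n, (a + j)) * ∏ j ∈ Finset.range n, (b + j))) := by
    intro n
    induction n with
    | zero => simp
    | succ n ih =>
      simp only [Finset.prod_range_succ]
      linear_combination ((∏ j ∈ Finset.range n, (c + j)) * ∏ j ∈ Finset.range n, (d + j)) * hs n +
        x * ((a + n) * (b + n)) * ih
  have lim := (((GammaSeq_tendsto_Gamma c).mul (GammaSeq_tendsto_Gamma d)).div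
    ((GammaSeq_tendsto_Gamma a).mul (GammaSeq_tendsto_Gamma b))
    (mul_ne_zero (gne a ha) (gne b hb))).const_mul (s 0)
  refine lim.congr' ?_
  filter_upwards [eventually_gt_atTop 0] with n hn
  have hn' : (0 : ℝ) < n := Nat.cast_pos.mpr hn
  have pne : ∀ t : ℝ, (∀ n : ℕ, t + n ≠ 0) → ∏ j ∈ Finset.range (n + 1), (t + j) ≠ 0 :=
    fun t ht => Finset.prod_ne_zero_iff.mpr fun j _ => ht j
  have h := closed (n + 1)
  have pa := pne a ha
  have pb := pne b hb
  have pc := pne c hc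
  have pd := pne d hd
  have hf : (n.factorial : ℝ) ≠ 0 := Nat.cast_ne_zero.mpr n.factorial_ne_zero
  have hs' : s (n + 1) / x ^ (n + 1) = s 0 * ((∏ j ∈ Finset.range (n + 1), (a + j)) *
      ∏ j ∈ Finset.range (n + 1), (b + j)) / ((∏ j ∈ Finset.range (n + 1), (c + j)) *
      ∏ j ∈ Finset.range (n + 1), (d + j)) := by
    rw [div_eq_div_iff (pow_ne_zero _ hx) (mul_ne_zero pc pd)]
    linear_combination h
  have ea := rpow_pos_of_pos hn' a
  have eb := rpow_pos_of_pos hn' b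
  simp only [Pi.div_apply, GammaSeq]
  rw [hs', rpow_sub hn', rpow_sub hn', rpow_add hn']
  field_simp

theorem Gamma_four_thirds_div : Gamma (4 / 3) * Gamma 1 / (Gamma (1 / 2) * Gamma (1 / 6)) =
    2 ^ ((1 : ℝ) / 3) * Gamma (2 / 3) / (6 * π) := by
  have h1 : Gamma (7 / 6) = 1 / 6 * Gamma (1 / 6) := by
    rw [← Gamma_add_one (by norm_num)]
    norm_num
  have h2 := Gamma_mul_Gamma_add_half (2 / 3)
  norm_num at h2
  rw [h1] at h2
  have h3 : (2 : ℝ) ^ ((1 : ℝ) / 3) * 2 ^ (-(1 / 3 : ℝ)) = 1 := by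
    rw [← rpow_add two_pos]
    norm_num
  have h4 : Gamma (1 / 6) ≠ 0 := (Gamma_pos_of_pos (by norm_num)).ne'
  have h5 : √π * √π = π := mul_self_sqrt pi_pos.le
  have h6 : √π ≠ 0 := (sqrt_pos.mpr pi_pos).ne'
  rw [Gamma_one, Gamma_one_half_eq, div_eq_div_iff (mul_ne_zero h6 h4)
    (mul_ne_zero (by norm_num) pi_ne_zero)]
  linear_combination -6 * √π * 2 ^ ((1 : ℝ) / 3) * h2 + -6 * Gamma (4 / 3) *
    (√π * √π * h3 + h5)

theorem tendsto_natCast_rpow_neg {e : ℝ} (he : 0 < e) :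
    Tendsto (fun n : ℕ => (n : ℝ) ^ (-e)) atTop (𝓝 0) :=
  (tendsto_rpow_neg_atTop he).comp tendsto_natCast_atTop_atTop

theorem tendsto_of_coefficient_sequences {c q F a y R : ℕ → ℝ}
    (hc : ∀ n, 3 * c n = 2 * F n + q n) (hq0 : q 0 = 1)
    (hq : ∀ n : ℕ, q (n + 1) * ((2 + n) * (3 + n)) = 16 * (q n * ((1 / 2 + n) * (3 / 2 + n))))
    (ha0 : a 0 = 1)
    (ha : ∀ n : ℕ, a (n + 1) * ((4 / 3 + n) * (1 + n)) =
      16 * (a n * ((1 / 2 + n) * (1 / 6 + n))))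
    (hy : ∀ n : ℕ, y (n + 1) * ((2 / 3 + n) * (1 + n)) =
        16 * (y n * ((1 / 2 + n) * (-1 / 6 + n))))
    (hR : ∀ n : ℕ, (n + 1) * |R n| ≤ 33 * (|y n| + |a n|))
    (hF : ∀ n, 81 * F n = 72 * a (n + 1) - 4 * R (n + 1)) :
    Tendsto (fun n : ℕ => c n / 16 ^ (n + 1) * (n : ℝ) ^ ((5 : ℝ) / 3)) atTop
      (𝓝 (16 / 27 * (2 ^ ((1 : ℝ) / 3) * Gamma (2 / 3) / (6 * π)))) := by
  have pos : ∀ t : ℝ, 0 < t → ∀ n : ℕ, t + n ≠ 0 := fun t ht n => by positivity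
  have neg : ∀ n : ℕ, (-1 / 6 : ℝ) + n ≠ 0 := by
    intro n h
    have : ((6 * n : ℕ) : ℝ) = (1 : ℕ) := by push_cast; linarith
    have := Nat.cast_injective this
    omega
  have la := tendsto_of_hypergeometric_recurrence (by norm_num) (pos _ (by norm_num))
    (pos _ (by norm_num)) (pos _ (by norm_num)) (pos _ (by norm_num)) ha
  have ly := tendsto_of_hypergeometric_recurrence (by norm_num) (pos _ (by norm_num))
    neg (pos _ (by norm_num)) (pos _ (by norm_num)) hy
  have lq := tendsto_of_hypergeometric_recurrence (by norm_num) (pos _ (by norm_num))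
    (pos _ (by norm_num)) (pos _ (by norm_num)) (pos _ (by norm_num)) hq
  rw [ha0, one_mul, Gamma_four_thirds_div,
    show (4 / 3 + 1 - 1 / 2 - 1 / 6 : ℝ) = 5 / 3 by norm_num] at la
  rw [show (2 / 3 + 1 - 1 / 2 - -1 / 6 : ℝ) = 4 / 3 by norm_num] at ly
  rw [show (2 + 3 - 1 / 2 - 3 / 2 : ℝ) = 3 by norm_num] at lq
  have lR : Tendsto (fun n : ℕ => R (n + 1) / 16 ^ (n + 1) * (n : ℝ) ^ ((5 : ℝ) / 3)) atTop
      (𝓝 0) := by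
    have l1 := (ly.abs.mul (tendsto_natCast_rpow_neg (e := 2 / 3) (by norm_num))).add
      (la.abs.mul (tendsto_natCast_rpow_neg one_pos))
    replace l1 := l1.const_mul 33
    rw [mul_zero, mul_zero, add_zero, mul_zero] at l1
    refine squeeze_zero_norm' ?_ l1
    filter_upwards [eventually_gt_atTop 0] with n hn
    have hn' : (0 : ℝ) < n := Nat.cast_pos.mpr hn
    have h1 : |R (n + 1)| ≤ 33 * (|y (n + 1)| + |a (n + 1)|) * (n : ℝ) ^ (-1 : ℝ) := by
      rw [rpow_neg_one, ← div_eq_mul_inv, le_div_iff₀ hn', mul_comm]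
      refine le_trans (mul_le_mul_of_nonneg_right ?_ (abs_nonneg _)) (hR (n + 1))
      push_cast
      linarith
    have h2 : (n : ℝ) ^ ((4 : ℝ) / 3) * (n : ℝ) ^ (-(2 / 3) : ℝ) =
        (n : ℝ) ^ (-1 : ℝ) * (n : ℝ) ^ ((5 : ℝ) / 3) := by
      rw [← rpow_add hn', ← rpow_add hn']
      norm_num
    have hp : ∀ e : ℝ, |(n : ℝ) ^ e| = (n : ℝ) ^ e := fun e => abs_of_pos (rpow_pos_of_pos hn' e)
    rw [norm_eq_abs]
    simp only [abs_mul, abs_div, abs_pow, hp]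
    rw [abs_of_pos (by norm_num : (0 : ℝ) < 16)]
    calc |R (n + 1)| / 16 ^ (n + 1) * (n : ℝ) ^ ((5 : ℝ) / 3)
        ≤ 33 * (|y (n + 1)| + |a (n + 1)|) * (n : ℝ) ^ (-1 : ℝ) / 16 ^ (n + 1) *
          (n : ℝ) ^ ((5 : ℝ) / 3) := by gcongr
      _ = _ := by linear_combination -33 * (|y (n + 1)| / 16 ^ (n + 1)) * h2
  have hq' : ∀ n, 0 ≤ q n := by
    intro n
    induction n with
    | zero => rw [hq0]; exact zero_le_one
    | succ n ih =>
      refine nonneg_of_mul_nonneg_left ?_ (by positivity : (0 : ℝ) < (2 + n) * (3 + n))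
      rw [hq n]
      positivity
  have lq' : Tendsto (fun n : ℕ => q n / 16 ^ (n + 1) * (n : ℝ) ^ ((5 : ℝ) / 3)) atTop
      (𝓝 0) := by
    have l1 := lq.mul (tendsto_natCast_rpow_neg (e := 4 / 3) (by norm_num))
    rw [mul_zero] at l1
    refine squeeze_zero' (.of_forall fun n => ?_) ?_ l1
    · have := hq' n
      positivity
    · filter_upwards [eventually_gt_atTop 0] with n hn
      have hn' : (0 : ℝ) < n := Nat.cast_pos.mpr hn
      have h1 : q n ≤ q (n + 1) := by
        refine le_of_mul_le_mul_right ?_ (by positivity : (0 : ℝ) < (2 + n) * (3 + n))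
        rw [hq n]
        nlinarith [mul_nonneg (hq' n) hn'.le, mul_nonneg (hq' n) (sq_nonneg (n : ℝ)), hq' n]
      rw [mul_assoc, ← rpow_add hn', show (3 + -(4 / 3) : ℝ) = 5 / 3 by norm_num]
      gcongr
  have key := ((la.const_mul (16 / 27)).sub (lR.const_mul (8 / 243))).add (lq'.const_mul (1 / 3))
  rw [mul_zero, mul_zero, sub_zero, add_zero] at key
  refine key.congr fun n => ?_
  linear_combination -(1 / 16 ^ (n + 1) * (n : ℝ) ^ ((5 : ℝ) / 3)) *
    (hc n / 3 + 2 / 243 * hF n)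

theorem isEquivalent_of_tendsto_mul_rpow {c : ℕ → ℝ}
    (h : Tendsto (fun n : ℕ => c n / 16 ^ (n + 1) * (n : ℝ) ^ ((5 : ℝ) / 3)) atTop
      (𝓝 (16 / 27 * (2 ^ ((1 : ℝ) / 3) * Gamma (2 / 3) / (6 * π))))) :
    Asymptotics.IsEquivalent atTop c
      (fun n : ℕ => 2 ^ 9 / 3 ^ 4 * (Gamma (2 / 3) / π) * 4 ^ (2 * n) /
        ((2 * n : ℕ) : ℝ) ^ ((5 : ℝ) / 3)) := by
  have hG : 0 < Gamma (2 / 3) := Gamma_pos_of_pos (by norm_num)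
  refine (Asymptotics.isEquivalent_iff_tendsto_one ?_).mpr ?_
  · filter_upwards [eventually_gt_atTop 0] with n hn
    have : (0 : ℝ) < n := Nat.cast_pos.mpr hn
    have := pi_pos
    push_cast
    positivity
  · have h2 := h.mul_const (16 * 2 ^ ((5 : ℝ) / 3) / (2 ^ 9 / 3 ^ 4 * (Gamma (2 / 3) / π)))
    have h3 : (2 : ℝ) ^ ((1 : ℝ) / 3) * 2 ^ ((5 : ℝ) / 3) = 4 := by
      rw [← rpow_add two_pos]
      norm_num
    have h4 : 16 / 27 * (2 ^ ((1 : ℝ) / 3) * Gamma (2 / 3) / (6 * π)) *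
        (16 * 2 ^ ((5 : ℝ) / 3) / (2 ^ 9 / 3 ^ 4 * (Gamma (2 / 3) / π))) = 1 := by
      field_simp
      linear_combination 20736 * h3
    rw [h4] at h2
    refine h2.congr fun n => ?_
    have h16 : (4 : ℝ) ^ (2 * n) = 16 ^ n := by
      rw [pow_mul]
      norm_num
    rw [Pi.div_apply, h16, pow_succ]
    push_cast
    rw [mul_rpow zero_le_two n.cast_nonneg]
    field_simp

end Asymptotics

theorem square_threeQuadrant_excursion_asymptotics :
    Asymptotics.IsEquivalent Filter.atTop
      (fun n : ℕ => (walkCount squareSteps coneC (0, 0) (0, 0) (2*n) : ℝ))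
      (fun n : ℕ =>
        2^9 / 3^4 * (Real.Gamma (2/3) / Real.pi) * 4^(2*n) /
          ((2 * n : ℕ) : ℝ)^((5 : ℝ)/3)) := by
  obtain ⟨g, q, κ, ρ, hq, hq0, hg, hκ, hρ, hF⟩ :=
    constant_row_one rowSeries_succ coeff_rowSeries_zero coeff_rowSeries_zero_neg
  obtain ⟨a, y, R, ha0, ha, -, hy, hR, hF⟩ := exists_coefficient_sequences hq hq0 hg hκ hρ hF
  refine isEquivalent_of_tendsto_mul_rpow (tendsto_of_coefficient_sequences
    (q := fun n => (quadrantExcursions n : ℝ))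
    (F := fun n => ((coneWalks (2 * n) 1 1 + coneWalks (2 * n) 1 (-1) : ℚ) : ℝ))
    (a := fun n => (a n : ℝ)) (y := fun n => (y n : ℝ)) (R := fun n => (R n : ℝ))
    (fun n => ?_) ?_ (fun n => ?_) ?_ (fun n => ?_) (fun n => ?_) (fun n => ?_) (fun n => ?_))
  · have h1 : coneWalks (2 * n) 1 1 = (walkCount squareSteps coneC (0, 0) (0, 0) (2 * n) : ℚ) := by
      rw [coneWalks, sub_self]
    have h2 := congrArg (Rat.cast : ℚ → ℝ) (coneWalks_excursion n)
    rw [Rat.cast_mul, h1] at h2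
    rw [h1]
    push_cast at h2 ⊢
    exact h2
  · rw [quadrantExcursions_zero, Rat.cast_one]
  · have := congrArg (Rat.cast : ℚ → ℝ) (quadrantExcursions_succ n)
    push_cast at this
    linear_combination this
  · rw [ha0, Rat.cast_one]
  · have := congrArg (Rat.cast : ℚ → ℝ) (ha n)
    push_cast at this
    exact this
  · have := congrArg (Rat.cast : ℚ → ℝ) (hy n)
    push_cast at this
    exact this
  · exact_mod_cast hR n
  · have := hF n
    rw [PowerSeries.coeff_mapFunctional, LaurentPolynomial.constantFunctional_apply,
      coeff_rowSeries_one] at this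
    exact_mod_cast this
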